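/- arXiv:1902.09019 — 6 statements merged into one kernel-verified Lean document; each statement's English description precedes it below -/
import Mathlib

section
/- Let λ ≥ 1 and let E = {n ∈ ℤ² : |n| = λ}. There is an absolute constant C > 0 such that for every choice of complex coefficients (c_n)_{n∈E}, every point x₀ ∈ ℝ² and every unit vector v ∈ ℝ², one has ∫₀¹ |Σ_{n∈E} c_n e^{i n·(x₀+tv)}|² dt ≤ C · N_{1,λ} · Σ_{n∈E} |c_n|². -/
open MeasureTheory

/-- Dot product of a lattice point `n ∈ ℤ^d` with a real vector `x ∈ ℝ^d`. -/
noncomputable def dotIR {d : ℕ} (n : Fin d → ℤ) (x : Fin d → ℝ) : ℝ :=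
  ∑ i, (n i : ℝ) * x i

/-- The number of lattice points of `ℤ^(k+1)` on the sphere of radius `lam`
that lie in the `lam^(1/2)`-cap centered at `ζ`. -/
noncomputable def capCount (k : ℕ) (lam : ℝ) (ζ : Fin (k + 1) → ℝ) : ℕ :=
  Set.ncard {n : Fin (k + 1) → ℤ |
    (∑ i, ((n i : ℝ)) ^ 2) = lam ^ 2 ∧ (∑ i, ((n i : ℝ) - ζ i) ^ 2) ≤ lam}

/-- `N_{k,lam}`: the maximal number of lattice points of `ℤ^(k+1)` in a
`lam^(1/2)`-cap of the sphere of radius `lam`. -/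
noncomputable def Ncap (k : ℕ) (lam : ℝ) : ℕ :=
  sSup {N : ℕ | ∃ ζ : Fin (k + 1) → ℝ, (∑ i, (ζ i) ^ 2) = lam ^ 2 ∧ N = capCount k lam ζ}


lemma aux_integral {ι : Type*} (s : Finset ι) (a : ι → ℂ) (w : ι → ℝ) :
    (∫ t in (0 : ℝ)..1, ‖∑ n ∈ s, a n * Complex.exp (Complex.I * ((w n * t : ℝ) : ℂ))‖ ^ 2)
      ≤ Real.exp 1 * ∑ n ∈ s, ∑ m ∈ s, ‖a n‖ * ‖a m‖ * (2 / (1 + (w n - w m) ^ 2)) := by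
  set F : ℝ → ℝ := fun t => ‖∑ n ∈ s, a n * Complex.exp (Complex.I * ((w n * t : ℝ) : ℂ))‖ ^ 2
    with hF
  have hFc : Continuous F := by rw [hF]; fun_prop
  have hF0 : ∀ t, 0 ≤ F t := fun t => by rw [hF]; positivity
  set G : ℝ → ℝ := fun t => Real.exp (-t) * (F t + F (-t)) with hG
  have hG0 : ∀ t, 0 ≤ G t := fun t => mul_nonneg (Real.exp_pos _).le (add_nonneg (hF0 _) (hF0 _))
  set K : ι → ι → ℝ → ℂ := fun n m t => a n * (starRingEnd ℂ) (a m) *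
      (Complex.exp ((-1 + Complex.I * ((w n - w m : ℝ) : ℂ)) * t) +
        Complex.exp ((-1 - Complex.I * ((w n - w m : ℝ) : ℂ)) * t)) with hK
  have hFexp : ∀ t : ℝ, ((F t : ℝ) : ℂ) = ∑ n ∈ s, ∑ m ∈ s, a n * (starRingEnd ℂ) (a m) *
      Complex.exp (Complex.I * ((w n - w m : ℝ) : ℂ) * t) := by
    intro t
    simp only [hF]
    rw [Complex.ofReal_pow, ← Complex.mul_conj', map_sum, Finset.sum_mul_sum]
    refine Finset.sum_congr rfl fun n _ => Finset.sum_congr rfl fun m _ => ?_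
    rw [map_mul, ← Complex.exp_conj]
    simp only [map_mul, Complex.conj_I, Complex.conj_ofReal]
    rw [mul_mul_mul_comm, ← Complex.exp_add]
    congr 2
    push_cast
    ring
  have hGexp : ∀ t : ℝ, ((G t : ℝ) : ℂ) = ∑ n ∈ s, ∑ m ∈ s, K n m t := by
    intro t
    simp only [hG, hK]
    rw [Complex.ofReal_mul, Complex.ofReal_add, hFexp, hFexp, ← Finset.sum_add_distrib,
      Finset.mul_sum]
    refine Finset.sum_congr rfl fun n _ => ?_
    rw [← Finset.sum_add_distrib, Finset.mul_sum]
    refine Finset.sum_congr rfl fun m _ => ?_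
    rw [← mul_add, mul_left_comm, mul_add, Complex.ofReal_exp, ← Complex.exp_add,
      ← Complex.exp_add]
    congr 3 <;> (congr 1; push_cast; ring)
  have hre1 : ∀ x : ℝ, (-1 + Complex.I * (x : ℂ)).re < 0 := fun x => by simp
  have hre2 : ∀ x : ℝ, (-1 - Complex.I * (x : ℂ)).re < 0 := fun x => by simp
  have hKint : ∀ n m, IntegrableOn (K n m) (Set.Ioi 0) := by
    intro n m
    exact ((integrableOn_exp_mul_complex_Ioi (hre1 _) 0).add
      (integrableOn_exp_mul_complex_Ioi (hre2 _) 0)).const_mul _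
  have hKval : ∀ n m, ∫ t in Set.Ioi (0 : ℝ), K n m t =
      a n * (starRingEnd ℂ) (a m) * ((2 / (1 + (w n - w m) ^ 2) : ℝ) : ℂ) := by
    intro n m
    simp only [hK]
    rw [integral_const_mul, integral_add (integrableOn_exp_mul_complex_Ioi (hre1 _) 0)
      (integrableOn_exp_mul_complex_Ioi (hre2 _) 0), integral_exp_mul_complex_Ioi (hre1 _),
      integral_exp_mul_complex_Ioi (hre2 _)]
    congr 1
    generalize w n - w m = x
    have h1 : (-1 + Complex.I * (x : ℂ)) ≠ 0 := fun h => by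
      have := hre1 x; rw [h] at this; simp at this
    have h2 : (-1 - Complex.I * (x : ℂ)) ≠ 0 := fun h => by
      have := hre2 x; rw [h] at this; simp at this
    have h3 : (1 + (x : ℂ) ^ 2) ≠ 0 := by
      have : (1 + x ^ 2 : ℝ) ≠ 0 := by positivity
      exact_mod_cast this
    push_cast
    simp only [mul_zero, Complex.exp_zero]
    rw [div_add_div _ _ h1 h2, div_eq_div_iff (mul_ne_zero h1 h2) h3]
    linear_combination (2 * (x:ℂ)^2) * Complex.I_sq
  have hGc : ∀ t : ℝ, ((G t : ℝ) : ℂ) = ∑ n ∈ s, ∑ m ∈ s, K n m t := hGexp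
  have hGintC : IntegrableOn (fun t => ((G t : ℝ) : ℂ)) (Set.Ioi 0) := by
    simp only [hGexp]
    exact integrable_finsetSum _ fun n _ => integrable_finsetSum _ fun m _ => hKint n m
  have hGint : IntegrableOn G (Set.Ioi 0) := by
    have := hGintC.re
    exact this
  have hval : ((∫ t in Set.Ioi (0 : ℝ), G t : ℝ) : ℂ) = ∑ n ∈ s, ∑ m ∈ s,
      a n * (starRingEnd ℂ) (a m) * ((2 / (1 + (w n - w m) ^ 2) : ℝ) : ℂ) := by
    rw [← integral_complex_ofReal]
    simp only [hGexp]
    rw [integral_finsetSum _ fun n _ => integrable_finsetSum _ fun m _ => hKint n m]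
    refine Finset.sum_congr rfl fun n _ => ?_
    rw [integral_finsetSum _ fun m _ => hKint n m]
    exact Finset.sum_congr rfl fun m _ => hKval n m
  have hbd : (∫ t in Set.Ioi (0 : ℝ), G t) ≤
      ∑ n ∈ s, ∑ m ∈ s, ‖a n‖ * ‖a m‖ * (2 / (1 + (w n - w m) ^ 2)) := by
    refine (le_abs_self _).trans ?_
    rw [← Real.norm_eq_abs, ← Complex.norm_real, hval]
    refine (norm_sum_le _ _).trans (Finset.sum_le_sum fun n _ => ?_)
    refine (norm_sum_le _ _).trans (Finset.sum_le_sum fun m _ => ?_)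
    rw [norm_mul, norm_mul, Complex.norm_conj, Complex.norm_real, Real.norm_eq_abs,
      abs_of_nonneg (by positivity)]
  have h1 : (∫ t in (0 : ℝ)..1, F t) ≤ ∫ t in (0:ℝ)..1, Real.exp 1 * G t := by
    have hGcont : Continuous G := by rw [hG]; fun_prop
    refine intervalIntegral.integral_mono_on zero_le_one (hFc.intervalIntegrable _ _)
      ((hGcont.const_mul _).intervalIntegrable _ _) fun t ht => ?_
    simp only [hG]
    rw [← mul_assoc, ← Real.exp_add]
    have : 1 ≤ Real.exp (1 + -t) := Real.one_le_exp (by linarith [ht.2])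
    nlinarith [hF0 t, hF0 (-t)]
  refine h1.trans ?_
  rw [intervalIntegral.integral_const_mul]
  refine mul_le_mul_of_nonneg_left (le_trans ?_ hbd) (Real.exp_pos _).le
  rw [intervalIntegral.integral_of_le zero_le_one]
  exact setIntegral_mono_set hGint (Filter.Eventually.of_forall hG0)
    (Set.Ioc_subset_Ioi_self.eventuallyLE)

lemma aux_schur {ι : Type*} (s : Finset ι) (a : ι → ℂ) (k : ι → ι → ℝ) (B : ℝ)
    (hk : ∀ n m, 0 ≤ k n m) (hsym : ∀ n m, k n m = k m n)
    (hB : ∀ n ∈ s, ∑ m ∈ s, k n m ≤ B) :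
    ∑ n ∈ s, ∑ m ∈ s, ‖a n‖ * ‖a m‖ * k n m ≤ B * ∑ n ∈ s, ‖a n‖ ^ 2 := by
  have h1 : ∑ n ∈ s, ∑ m ∈ s, ‖a n‖ * ‖a m‖ * k n m ≤
      ∑ n ∈ s, ∑ m ∈ s, (‖a n‖ ^ 2 * k n m / 2 + ‖a m‖ ^ 2 * k m n / 2) := by
    refine Finset.sum_le_sum fun n _ => Finset.sum_le_sum fun m _ => ?_
    rw [hsym m n]
    nlinarith [mul_nonneg (hk n m) (sq_nonneg (‖a n‖ - ‖a m‖))]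
  refine h1.trans ?_
  simp only [Finset.sum_add_distrib]
  rw [Finset.sum_comm (f := fun n m => ‖a m‖ ^ 2 * k m n / 2), ← Finset.sum_add_distrib,
    Finset.mul_sum]
  refine Finset.sum_le_sum fun n hn => ?_
  rw [← Finset.sum_div, ← Finset.mul_sum]
  nlinarith [mul_le_mul_of_nonneg_left (hB n hn) (sq_nonneg ‖a n‖)]

lemma aux_cap (lam : ℝ) (E : Finset (Fin 2 → ℤ))
    (hE : ∀ n : Fin 2 → ℤ, n ∈ E ↔ (∑ i, ((n i : ℝ)) ^ 2) = lam ^ 2)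
    (A : Finset (Fin 2 → ℤ)) (hA : A ⊆ E)
    (hd : ∀ n ∈ A, ∀ m ∈ A, (∑ i, ((m i : ℝ) - n i) ^ 2) ≤ lam) :
    A.card ≤ Ncap 1 lam := by
  rcases A.eq_empty_or_nonempty with rfl | ⟨n, hn⟩
  · simp
  have hfin : ∀ ζ : Fin 2 → ℝ, {m : Fin 2 → ℤ | (∑ i, ((m i : ℝ)) ^ 2) = lam ^ 2 ∧
      (∑ i, ((m i : ℝ) - ζ i) ^ 2) ≤ lam} ⊆ (E : Set (Fin 2 → ℤ)) := by
    intro ζ m hm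
    exact (hE m).2 hm.1
  have h1 : A.card ≤ capCount 1 lam (fun i => (n i : ℝ)) := by
    rw [← Set.ncard_coe_finset]
    refine Set.ncard_le_ncard ?_ (E.finite_toSet.subset (hfin _))
    intro m hm
    exact ⟨(hE m).1 (hA hm), hd n hn m hm⟩
  refine h1.trans (le_csSup ⟨E.card, ?_⟩ ⟨_, (hE n).1 (hA hn), rfl⟩)
  rintro N ⟨ζ, -, rfl⟩
  rw [← Set.ncard_coe_finset]
  exact Set.ncard_le_ncard (hfin ζ) E.finite_toSet

lemma aux_geom (lam x y x' y' p q b : ℝ) (hl : 1 ≤ lam) (h : x ^ 2 + y ^ 2 = lam ^ 2)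
    (h' : x' ^ 2 + y' ^ 2 = lam ^ 2) (hpq : p ^ 2 + q ^ 2 = 1)
    (h1 : b ≤ x * p + y * q) (h2 : x * p + y * q ≤ b + 1 / 4)
    (h1' : b ≤ x' * p + y' * q) (h2' : x' * p + y' * q ≤ b + 1 / 4)
    (hs : 0 ≤ (x * q - y * p) * (x' * q - y' * p)) :
    (x - x') ^ 2 + (y - y') ^ 2 ≤ lam := by
  obtain ⟨s, hsd⟩ : ∃ s, s = x * p + y * q := ⟨_, rfl⟩
  obtain ⟨s', hsd'⟩ : ∃ s, s = x' * p + y' * q := ⟨_, rfl⟩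
  obtain ⟨w, hw⟩ : ∃ s, s = x * q - y * p := ⟨_, rfl⟩
  obtain ⟨w', hw'⟩ : ∃ s, s = x' * q - y' * p := ⟨_, rfl⟩
  rw [← hsd] at h1 h2
  rw [← hsd'] at h1' h2'
  rw [← hw, ← hw'] at hs
  have e1 : s ^ 2 + w ^ 2 = lam ^ 2 := by
    rw [hsd, hw, ← h]; linear_combination (x ^ 2 + y ^ 2) * hpq
  have e2 : s' ^ 2 + w' ^ 2 = lam ^ 2 := by
    rw [hsd', hw', ← h']; linear_combination (x' ^ 2 + y' ^ 2) * hpq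
  have e3 : (x - x') ^ 2 + (y - y') ^ 2 = (s - s') ^ 2 + (w - w') ^ 2 := by
    rw [hsd, hw, hsd', hw']; linear_combination (-(x - x') ^ 2 - (y - y') ^ 2) * hpq
  rw [e3]
  have hs1 : |s| ≤ lam := abs_le_of_sq_le_sq (by nlinarith [sq_nonneg w]) (by linarith)
  have hs2 : |s'| ≤ lam := abs_le_of_sq_le_sq (by nlinarith [sq_nonneg w']) (by linarith)
  have hds : |s - s'| ≤ 1 / 4 := abs_le.2 ⟨by linarith, by linarith⟩
  have hww : |w - w'| ≤ |w + w'| := sq_le_sq.1 (by nlinarith)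
  have hk : (w - w') ^ 2 ≤ |s - s'| * |s + s'| := by
    calc (w - w') ^ 2 = |w - w'| * |w - w'| := by rw [abs_mul_abs_self]; ring
      _ ≤ |w - w'| * |w + w'| := by gcongr
      _ = |s - s'| * |s + s'| := by
        rw [← abs_mul, ← abs_mul, ← abs_neg]; congr 1; linear_combination e2 - e1
  have hss : |s + s'| ≤ 2 * lam := (abs_add_le _ _).trans (by linarith)
  have hm : |s - s'| * |s + s'| ≤ 1 / 4 * (2 * lam) := by gcongr
  have hsq : (s - s') ^ 2 ≤ 1 / 16 := by
    rw [← sq_abs]; nlinarith [abs_nonneg (s - s')]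
  linarith

lemma aux_count (lam : ℝ) (hl : 1 ≤ lam) (E : Finset (Fin 2 → ℤ))
    (hE : ∀ n : Fin 2 → ℤ, n ∈ E ↔ (∑ i, ((n i : ℝ)) ^ 2) = lam ^ 2)
    (v : Fin 2 → ℝ) (hv : (∑ i, (v i) ^ 2) = 1) (b : ℝ)
    (A : Finset (Fin 2 → ℤ)) (hA : A ⊆ E)
    (hd : ∀ n ∈ A, b ≤ dotIR n v ∧ dotIR n v ≤ b + 1 / 4) :
    A.card ≤ 2 * Ncap 1 lam := by
  classical
  have key : ∀ B : Finset (Fin 2 → ℤ), B ⊆ A →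
      (∀ n ∈ B, ∀ m ∈ B, 0 ≤ ((m 0 : ℝ) * v 1 - m 1 * v 0) * ((n 0 : ℝ) * v 1 - n 1 * v 0)) →
      B.card ≤ Ncap 1 lam := by
    intro B hB hs
    refine aux_cap lam E hE B (hB.trans hA) fun n hn m hm => ?_
    have a1 := (hE n).1 (hA (hB hn))
    have a2 := (hE m).1 (hA (hB hm))
    have a3 := hd n (hB hn)
    have a4 := hd m (hB hm)
    simp only [dotIR, Fin.sum_univ_two] at a1 a2 a3 a4 hv ⊢
    exact aux_geom lam _ _ _ _ _ _ b hl a2 a1 hv a4.1 a4.2 a3.1 a3.2 (hs n hn m hm)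
  rw [← Finset.card_filter_add_card_filter_not
    (fun m : Fin 2 → ℤ => 0 ≤ (m 0 : ℝ) * v 1 - m 1 * v 0)]
  have k1 := key (A.filter (fun m : Fin 2 → ℤ => 0 ≤ (m 0 : ℝ) * v 1 - m 1 * v 0))
    (Finset.filter_subset _ _) (fun n hn m hm => mul_nonneg (Finset.mem_filter.1 hm).2
      (Finset.mem_filter.1 hn).2)
  have k2 := key (A.filter (fun m : Fin 2 → ℤ => ¬ 0 ≤ (m 0 : ℝ) * v 1 - m 1 * v 0))
    (Finset.filter_subset _ _) (fun n hn m hm => mul_nonneg_of_nonpos_of_nonpos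
      (not_le.1 (Finset.mem_filter.1 hm).2).le (not_le.1 (Finset.mem_filter.1 hn).2).le)
  omega

lemma aux_summable : Summable (fun j : ℤ => 1 / (1 + (j : ℝ) ^ 2)) := by
  have h : Summable (fun j : ℤ => 1 / (j : ℝ) ^ 2) :=
    Real.summable_one_div_int_pow.2 (by norm_num)
  have h0 : Summable (fun j : ℤ => if j = 0 then (1 : ℝ) else 0) :=
    (hasSum_ite_eq (0 : ℤ) (1 : ℝ)).summable
  refine Summable.of_nonneg_of_le (fun j => by positivity) (fun j => ?_) (h.add h0)
  by_cases hj : j = 0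
  · simp [hj]
  · have : (0 : ℝ) < (j : ℝ) ^ 2 := by positivity
    simp only [hj, if_false, add_zero]
    exact one_div_le_one_div_of_le this (by linarith)

lemma aux_row (lam : ℝ) (hl : 1 ≤ lam) (E : Finset (Fin 2 → ℤ))
    (hE : ∀ n : Fin 2 → ℤ, n ∈ E ↔ (∑ i, ((n i : ℝ)) ^ 2) = lam ^ 2)
    (v : Fin 2 → ℝ) (hv : (∑ i, (v i) ^ 2) = 1) (x : ℝ) :
    ∑ m ∈ E, (2 : ℝ) / (1 + (x - dotIR m v) ^ 2) ≤
      64 * (∑' j : ℤ, 1 / (1 + (j : ℝ) ^ 2)) * (2 * (Ncap 1 lam : ℝ)) := by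
  classical
  set J : (Fin 2 → ℤ) → ℤ := fun m => ⌊4 * (dotIR m v - x)⌋ with hJ
  have h1 : ∀ m ∈ E, 2 / (1 + (x - dotIR m v) ^ 2) ≤ 64 * (1 / (1 + ((J m : ℤ) : ℝ) ^ 2)) := by
    intro m _
    have f1 : (J m : ℝ) ≤ 4 * (dotIR m v - x) := Int.floor_le _
    have f2 : 4 * (dotIR m v - x) < J m + 1 := Int.lt_floor_add_one _
    generalize (J m : ℝ) = j at *
    rw [mul_one_div, div_le_div_iff₀ (by positivity) (by positivity)]
    generalize dotIR m v = y at *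
    have : (j - 4 * (y - x)) ^ 2 ≤ 1 := by nlinarith
    nlinarith [sq_nonneg (j - 8 * (y - x))]
  refine (Finset.sum_le_sum h1).trans ?_
  rw [← Finset.mul_sum, mul_assoc]
  refine mul_le_mul_of_nonneg_left ?_ (by norm_num)
  rw [← Finset.sum_fiberwise_of_maps_to (g := J) (t := E.image J)
    (fun m hm => Finset.mem_image_of_mem _ hm)]
  have h2 : ∀ j ∈ E.image J, ∑ m ∈ E with J m = j, 1 / (1 + ((J m : ℤ) : ℝ) ^ 2) ≤
      1 / (1 + (j : ℝ) ^ 2) * (2 * (Ncap 1 lam : ℝ)) := by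
    intro j _
    rw [Finset.sum_congr rfl (g := fun _ => 1 / (1 + (j : ℝ) ^ 2))
      (fun m hm => by rw [(Finset.mem_filter.1 hm).2])]
    rw [Finset.sum_const, nsmul_eq_mul, mul_comm]
    refine mul_le_mul_of_nonneg_left ?_ (by positivity)
    have := aux_count lam hl E hE v hv (x + j / 4) (E.filter (fun m => J m = j))
      (Finset.filter_subset _ _) (fun m hm => by
        have e := (Finset.mem_filter.1 hm).2
        have f1 : (J m : ℝ) ≤ 4 * (dotIR m v - x) := Int.floor_le _
        have f2 : 4 * (dotIR m v - x) < J m + 1 := Int.lt_floor_add_one _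
        rw [e] at f1 f2
        constructor <;> linarith)
    exact_mod_cast this
  refine (Finset.sum_le_sum h2).trans ?_
  rw [← Finset.sum_mul]
  refine mul_le_mul_of_nonneg_right ?_ (by positivity)
  exact aux_summable.sum_le_tsum _ (fun j _ => by positivity)

theorem stmt0 :
    ∃ C : ℝ, 0 < C ∧
      ∀ (lam : ℝ), 1 ≤ lam →
        ∀ (E : Finset (Fin 2 → ℤ)),
          (∀ n : Fin 2 → ℤ, n ∈ E ↔ (∑ i, ((n i : ℝ)) ^ 2) = lam ^ 2) →
            ∀ (c : (Fin 2 → ℤ) → ℂ) (x₀ v : Fin 2 → ℝ), (∑ i, (v i) ^ 2) = 1 →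
              (∫ t in (0 : ℝ)..1,
                  ‖∑ n ∈ E, c n *
                    Complex.exp (Complex.I * (dotIR n (fun i => x₀ i + t * v i) : ℂ))‖ ^ 2)
                ≤ C * (Ncap 1 lam) * ∑ n ∈ E, ‖c n‖ ^ 2 := by
  have hS : 0 ≤ ∑' j : ℤ, 1 / (1 + (j : ℝ) ^ 2) := tsum_nonneg fun j => by positivity
  have hS' : 0 < ∑' j : ℤ, 1 / (1 + (j : ℝ) ^ 2) :=
    aux_summable.tsum_pos (fun j => by positivity) 0 (by simp)
  refine ⟨Real.exp 1 * (64 * (∑' j : ℤ, 1 / (1 + (j : ℝ) ^ 2)) * 2), by positivity, ?_⟩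
  intro lam hl E hE c x₀ v hv
  have h1 := aux_integral E (fun n => c n * Complex.exp (Complex.I * ((dotIR n x₀ : ℝ) : ℂ)))
    (fun n => dotIR n v)
  have hn : ∀ n, ‖c n * Complex.exp (Complex.I * ((dotIR n x₀ : ℝ) : ℂ))‖ = ‖c n‖ := by
    intro n
    rw [norm_mul, mul_comm Complex.I, Complex.norm_exp_ofReal_mul_I, mul_one]
  simp only [hn] at h1
  have h2 := aux_schur E c (fun n m => 2 / (1 + (dotIR n v - dotIR m v) ^ 2)) _
    (fun n m => by positivity) (fun n m => by congr 2; ring)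
    (fun n _ => aux_row lam hl E hE v hv (dotIR n v))
  have h3 := h1.trans (mul_le_mul_of_nonneg_left h2 (Real.exp_pos 1).le)
  refine le_trans (le_of_eq ?_) (h3.trans (le_of_eq ?_))
  · congr 1
    funext t
    congr 2
    refine Finset.sum_congr rfl fun n _ => ?_
    rw [mul_assoc, ← Complex.exp_add]
    congr 2
    rw [← mul_add, ← Complex.ofReal_add]
    congr 2
    simp only [dotIR, Fin.sum_univ_two]
    ring
  · ring
end

section
/- There is a constant c > 0 such that for every λ ≥ 1 with {n ∈ ℤ² : |n| = λ} ≠ ∅, there exist a point x₀ ∈ ℝ², a unit vector v ∈ ℝ², and complex coefficients (c_n)_{n∈E} with Σ_{n∈E} |c_n|² = 1 (where E = {n ∈ ℤ² : |n| = λ}) such that ∫₀¹ |Σ_{n∈E} c_n e^{i n·(x₀+tv)}|² dt ≥ c · N_{1,λ}. In particular the bound ‖e_λ‖_{L²(γ)} ≲ √(N_{1,λ}) ‖e_λ‖_{L²(T²)} for geodesic segments is sharp. -/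
open MeasureTheory

lemma key_pointwise (lam : ℝ) (hl : 1 ≤ lam) (S : Finset (Fin 2 → ℤ)) (ζ : Fin 2 → ℝ)
    (hζ : ∑ i, (ζ i) ^ 2 = lam ^ 2)
    (hS : ∀ n ∈ S, (∑ i, ((n i : ℝ)) ^ 2) = lam ^ 2 ∧ (∑ i, ((n i : ℝ) - ζ i) ^ 2) ≤ lam)
    (t : ℝ) (ht0 : 0 ≤ t) (ht1 : t ≤ 1) (r : ℝ) (hr : 0 ≤ r) :
    (S.card : ℝ) * (r / 2) ≤ ‖∑ n ∈ S, (r : ℂ) *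
      Complex.exp (Complex.I * (dotIR n (fun i => 0 + t * (ζ i / lam)) : ℂ))‖ := by
  have hl0 : 0 < lam := by linarith
  have h1 : ‖∑ n ∈ S, (r : ℂ) *
      Complex.exp (Complex.I * (dotIR n (fun i => 0 + t * (ζ i / lam)) : ℂ))‖
      = ‖∑ n ∈ S, (r : ℂ) *
      Complex.exp (((dotIR n (fun i => 0 + t * (ζ i / lam)) - lam * t : ℝ) : ℂ) * Complex.I)‖ := by
    have : ∀ n : Fin 2 → ℤ, (r : ℂ) *
      Complex.exp (Complex.I * (dotIR n (fun i => 0 + t * (ζ i / lam)) : ℂ)) =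
      Complex.exp (((lam * t : ℝ) : ℂ) * Complex.I) * ((r : ℂ) *
      Complex.exp (((dotIR n (fun i => 0 + t * (ζ i / lam)) - lam * t : ℝ) : ℂ) * Complex.I)) := by
      intro n
      rw [mul_left_comm, ← Complex.exp_add]
      congr 2
      push_cast
      ring
    rw [Finset.sum_congr rfl (fun n _ => this n), ← Finset.mul_sum, norm_mul,
      Complex.norm_exp_ofReal_mul_I, one_mul]
  rw [h1]
  refine le_trans ?_ (Complex.re_le_norm _)
  rw [Complex.re_sum, ← nsmul_eq_mul]
  apply Finset.card_nsmul_le_sum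
  intro n hn
  obtain ⟨ha, hb⟩ := hS n hn
  rw [Complex.re_ofReal_mul, Complex.exp_ofReal_mul_I_re]
  simp only [Fin.sum_univ_two] at hζ ha hb
  set y := dotIR n (fun i => 0 + t * (ζ i / lam)) - lam * t with hy
  set p := ((n 0 : ℝ) * ζ 0 + n 1 * ζ 1) / lam with hp
  have hpl : p * lam = (n 0 : ℝ) * ζ 0 + n 1 * ζ 1 := by rw [hp]; field_simp
  have hyp : y = t * (p - lam) := by
    rw [hy, hp]; simp only [dotIR, Fin.sum_univ_two]; field_simp; ring
  have hp1 : p ≤ lam := by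
    refine le_of_mul_le_mul_right ?_ hl0
    nlinarith [sq_nonneg ((n 0 : ℝ) - ζ 0), sq_nonneg ((n 1 : ℝ) - ζ 1)]
  have hp2 : lam - 1 / 2 ≤ p := by
    refine le_of_mul_le_mul_right ?_ hl0
    nlinarith
  have hy1 : y ≤ 0 := by rw [hyp]; nlinarith
  have hy2 : -(1/2) ≤ y := by rw [hyp]; nlinarith
  have hc := Real.one_sub_sq_div_two_le_cos (x := y)
  have : (1 / 2 : ℝ) ≤ Real.cos y := by nlinarith
  nlinarith

theorem stmt1 :
    ∃ c₀ : ℝ, 0 < c₀ ∧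
      ∀ (lam : ℝ), 1 ≤ lam →
        ∀ (E : Finset (Fin 2 → ℤ)),
          (∀ n : Fin 2 → ℤ, n ∈ E ↔ (∑ i, ((n i : ℝ)) ^ 2) = lam ^ 2) →
          E.Nonempty →
            ∃ (x₀ v : Fin 2 → ℝ) (c : (Fin 2 → ℤ) → ℂ),
              (∑ i, (v i) ^ 2) = 1 ∧
              (∑ n ∈ E, ‖c n‖ ^ 2) = 1 ∧
              c₀ * (Ncap 1 lam) ≤
                ∫ t in (0 : ℝ)..1,
                  ‖∑ n ∈ E, c n *
                    Complex.exp (Complex.I * (dotIR n (fun i => x₀ i + t * v i) : ℂ))‖ ^ 2 := by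
  classical
  refine ⟨1 / 4, by norm_num, ?_⟩
  intro lam hl E hE hne
  have hl0 : 0 < lam := by linarith
  have hcap : ∀ ζ : Fin 2 → ℝ, capCount 1 lam ζ =
      (E.filter (fun n => (∑ i, ((n i : ℝ) - ζ i) ^ 2) ≤ lam)).card := by
    intro ζ
    rw [capCount, ← Set.ncard_coe_finset]
    congr 1
    ext n
    simp [hE]
  obtain ⟨n0, hn0⟩ := hne
  set A := {N : ℕ | ∃ ζ : Fin (1 + 1) → ℝ, (∑ i, (ζ i) ^ 2) = lam ^ 2 ∧ N = capCount 1 lam ζ}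
    with hA
  have hmem0 : capCount 1 lam (fun i => (n0 i : ℝ)) ∈ A := ⟨_, (hE n0).1 hn0, rfl⟩
  have hbdd : BddAbove A := by
    refine ⟨E.card, ?_⟩
    rintro N ⟨ζ, -, rfl⟩
    rw [hcap]
    exact Finset.card_filter_le _ _
  have hpos : 0 < Ncap 1 lam := by
    refine lt_of_lt_of_le ?_ (le_csSup hbdd hmem0)
    rw [hcap, Finset.card_pos]
    exact ⟨n0, by simp [hn0]; linarith⟩
  obtain ⟨ζ, hζ, hN⟩ : Ncap 1 lam ∈ A := Nat.sSup_mem ⟨_, hmem0⟩ hbdd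
  rw [hcap] at hN
  set S := E.filter (fun n => (∑ i, ((n i : ℝ) - ζ i) ^ 2) ≤ lam) with hSdef
  set M : ℝ := (Ncap 1 lam : ℝ) with hM
  have hM0 : 0 < M := by rw [hM]; exact_mod_cast hpos
  have hcard : (S.card : ℝ) = M := by rw [hM, hN]
  set r : ℝ := (Real.sqrt M)⁻¹ with hr
  have hr0 : 0 ≤ r := by positivity
  have hr2 : r ^ 2 = M⁻¹ := by rw [hr, inv_pow, Real.sq_sqrt hM0.le]
  refine ⟨fun _ => 0, fun i => ζ i / lam, fun n => if n ∈ S then (r : ℂ) else 0, ?_, ?_, ?_⟩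
  · simp only [div_pow, ← Finset.sum_div]
    rw [hζ]
    field_simp
  · have : ∀ n : Fin 2 → ℤ, ‖(if n ∈ S then (r : ℂ) else 0)‖ ^ 2 = if n ∈ S then r ^ 2 else 0 := by
      intro n
      split_ifs <;> simp
    simp only [this]
    rw [← Finset.sum_filter, Finset.filter_mem_eq_inter,
      Finset.inter_eq_right.2 (Finset.filter_subset _ _), Finset.sum_const, nsmul_eq_mul, hcard, hr2]
    field_simp
  · have hsum : ∀ t : ℝ, ∑ n ∈ E, (if n ∈ S then (r : ℂ) else 0) *
        Complex.exp (Complex.I * (dotIR n (fun i => 0 + t * (ζ i / lam)) : ℂ)) =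
        ∑ n ∈ S, (r : ℂ) *
        Complex.exp (Complex.I * (dotIR n (fun i => 0 + t * (ζ i / lam)) : ℂ)) := by
      intro t
      simp only [ite_mul, zero_mul]
      rw [← Finset.sum_filter, Finset.filter_mem_eq_inter,
        Finset.inter_eq_right.2 (Finset.filter_subset _ _)]
    simp only [hsum]
    have hconst : (1 / 4) * M = ∫ t in (0 : ℝ)..1, (1 / 4) * M := by simp
    rw [hconst]
    apply intervalIntegral.integral_mono_on (by norm_num)
    · exact intervalIntegrable_const
    · apply Continuous.intervalIntegrable
      unfold dotIR
      fun_prop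
    · intro t ht
      have hk := key_pointwise lam hl S ζ hζ (fun n hn => by
        rw [hSdef, Finset.mem_filter] at hn
        exact ⟨(hE n).1 hn.1, hn.2⟩) t ht.1 ht.2 r hr0
      rw [hcard] at hk
      have h2 := pow_le_pow_left₀ (by positivity) hk 2
      refine le_trans (le_of_eq ?_) h2
      rw [mul_pow, div_pow, hr2]
      field_simp
      norm_num
end

section
/- Let p, q be coprime integers with q ≠ 0 and |p| ≤ |q|, and let v = (q,p)/√(p²+q²), so that t ↦ x₀ + t v is a geodesic segment of T² with rational slope p/q. There is an absolute constant C > 0 such that for every λ ≥ 1, every x₀ ∈ ℝ², and every choice of complex coefficients (c_n)_{n∈E} with E = {n ∈ ℤ² : |n| = λ}, one has ∫₀¹ |Σ_{n∈E} c_n e^{i n·(x₀+tv)}|² dt ≤ C · |q| · Σ_{n∈E} |c_n|². In particular the constant is independent of λ. -/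
open MeasureTheory

theorem aux_int (k : ℤ) (s : ℝ) (hs : 0 < s) :
    ∫ t in (0:ℝ)..(2 * Real.pi * s), Complex.exp (Complex.I * k / s * t)
      = if k = 0 then ((2 * Real.pi * s : ℝ) : ℂ) else 0 := by
  split_ifs with h
  · subst h; simp
  · have hs' : (s : ℂ) ≠ 0 := by exact_mod_cast hs.ne'
    have hk : (k : ℂ) ≠ 0 := by exact_mod_cast h
    have hc : Complex.I * k / s ≠ 0 := div_ne_zero (mul_ne_zero Complex.I_ne_zero hk) hs'
    rw [integral_exp_mul_complex hc]
    have : Complex.I * k / s * ((2 * Real.pi * s : ℝ) : ℂ) = k * (2 * Real.pi * Complex.I) := by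
      push_cast; field_simp
    rw [this, Complex.exp_int_mul_two_pi_mul_I]
    simp

theorem aux_key {α : Type*} (E : Finset α) (a : α → ℂ) (m : α → ℤ) (s : ℝ) (hs : 0 < s)
    (hs1 : 1 ≤ 2 * Real.pi * s)
    (hf : ∀ n ∈ E, (E.filter (fun n' => m n = m n')).card ≤ 2) :
    (∫ t in (0:ℝ)..1, ‖∑ n ∈ E, a n * Complex.exp (Complex.I * m n / s * t)‖ ^ 2)
      ≤ 4 * Real.pi * s * ∑ n ∈ E, ‖a n‖ ^ 2 := by
  set F : ℝ → ℝ := fun t => ‖∑ n ∈ E, a n * Complex.exp (Complex.I * m n / s * t)‖ ^ 2 with hF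
  have hcont : Continuous F := by rw [hF]; fun_prop
  have h1 : (∫ t in (0:ℝ)..1, F t) ≤ ∫ t in (0:ℝ)..(2 * Real.pi * s), F t := by
    apply intervalIntegral.integral_mono_interval le_rfl zero_le_one hs1
    · exact Filter.Eventually.of_forall (fun t => by simp only [hF]; positivity)
    · exact hcont.intervalIntegrable _ _
  have h2 : ((∫ t in (0:ℝ)..(2 * Real.pi * s), F t : ℝ) : ℂ)
      = ∑ n ∈ E, ∑ n' ∈ E, (a n * (starRingEnd ℂ) (a n')) *
          (if m n = m n' then ((2 * Real.pi * s : ℝ) : ℂ) else 0) := by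
    rw [← intervalIntegral.integral_ofReal]
    have : ∀ t : ℝ, ((F t : ℝ) : ℂ) = ∑ n ∈ E, ∑ n' ∈ E, (a n * (starRingEnd ℂ) (a n')) *
        Complex.exp (Complex.I * ((m n - m n' : ℤ) : ℂ) / s * t) := by
      intro t
      simp only [hF]
      push_cast
      rw [← Complex.mul_conj', map_sum, Finset.sum_mul_sum]
      refine Finset.sum_congr rfl fun n _ => Finset.sum_congr rfl fun n' _ => ?_
      rw [map_mul, ← Complex.exp_conj, mul_mul_mul_comm, ← Complex.exp_add]
      congr 2
      simp
      ring
    simp_rw [this]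
    rw [intervalIntegral.integral_finsetSum]
    · refine Finset.sum_congr rfl fun n _ => ?_
      rw [intervalIntegral.integral_finsetSum]
      · refine Finset.sum_congr rfl fun n' _ => ?_
        rw [intervalIntegral.integral_const_mul, aux_int _ _ hs]
        simp only [sub_eq_zero]
      · intro i _
        exact Continuous.intervalIntegrable (by fun_prop) _ _
    · intro i _
      exact Continuous.intervalIntegrable (by fun_prop) _ _
  have hP : 0 < 2 * Real.pi * s := by positivity
  have h3 : (∫ t in (0:ℝ)..(2 * Real.pi * s), F t)
      ≤ ∑ n ∈ E, ∑ n' ∈ E, (if m n = m n' then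
          (2 * Real.pi * s) * ((‖a n‖ ^ 2 + ‖a n'‖ ^ 2) / 2) else 0) := by
    rw [← Complex.ofReal_re (∫ t in (0:ℝ)..(2 * Real.pi * s), F t), h2]
    refine (Complex.re_le_norm _).trans ?_
    refine (norm_sum_le _ _).trans (Finset.sum_le_sum fun n _ => ?_)
    refine (norm_sum_le _ _).trans (Finset.sum_le_sum fun n' _ => ?_)
    split_ifs
    · rw [norm_mul, norm_mul, RCLike.norm_conj, Complex.norm_real, Real.norm_of_nonneg hP.le,
        mul_comm]
      gcongr
      nlinarith [sq_nonneg (‖a n‖ - ‖a n'‖)]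
    · simp
  have h4 : ∑ n ∈ E, ∑ n' ∈ E, (if m n = m n' then ‖a n‖ ^ 2 else 0)
      ≤ 2 * ∑ n ∈ E, ‖a n‖ ^ 2 := by
    rw [Finset.mul_sum]
    refine Finset.sum_le_sum fun n hn => ?_
    rw [← Finset.sum_filter, Finset.sum_const, nsmul_eq_mul]
    have : ((E.filter (fun n' => m n = m n')).card : ℝ) ≤ 2 := by exact_mod_cast hf n hn
    gcongr
  have h5 : ∑ n ∈ E, ∑ n' ∈ E, (if m n = m n' then ‖a n'‖ ^ 2 else 0)
      = ∑ n ∈ E, ∑ n' ∈ E, (if m n = m n' then ‖a n‖ ^ 2 else 0) := by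
    rw [Finset.sum_comm]
    refine Finset.sum_congr rfl fun n _ => Finset.sum_congr rfl fun n' _ => ?_
    simp only [eq_comm]
  have h6 : ∑ n ∈ E, ∑ n' ∈ E, (if m n = m n' then
          (2 * Real.pi * s) * ((‖a n‖ ^ 2 + ‖a n'‖ ^ 2) / 2) else 0)
      = (2 * Real.pi * s) / 2 * (∑ n ∈ E, ∑ n' ∈ E, (if m n = m n' then ‖a n‖ ^ 2 else 0)
        + ∑ n ∈ E, ∑ n' ∈ E, (if m n = m n' then ‖a n'‖ ^ 2 else 0)) := by
    simp only [← Finset.sum_add_distrib, Finset.mul_sum]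
    refine Finset.sum_congr rfl fun n _ => Finset.sum_congr rfl fun n' _ => ?_
    split_ifs <;> ring
  rw [h6, h5] at h3
  have h7 := mul_le_mul_of_nonneg_left h4 hP.le
  linarith

theorem aux_card (p q : ℤ) (hq : q ≠ 0) (lam : ℝ) (E : Finset (Fin 2 → ℤ))
    (hE : ∀ n : Fin 2 → ℤ, n ∈ E ↔ (∑ i, ((n i : ℝ)) ^ 2) = lam ^ 2)
    (n : Fin 2 → ℤ) (hn : n ∈ E) :
    (E.filter (fun n' => q * n 0 + p * n 1 = q * n' 0 + p * n' 1)).card ≤ 2 := by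
  have hpq : 0 < p ^ 2 + q ^ 2 := by positivity
  let w : (Fin 2 → ℤ) → ℤ := fun n => q * n 1 - p * n 0
  refine (Finset.card_le_card_of_injOn w (t := {w n, - w n}) ?_ ?_).trans Finset.card_le_two
  · intro n' hn'
    simp only [Finset.coe_filter, Set.mem_ofPred_eq] at hn'
    obtain ⟨h1, h2⟩ := hn'
    rw [hE] at hn h1
    rw [← hn] at h1
    simp only [Fin.sum_univ_two] at h1
    have h1' : n' 0 ^ 2 + n' 1 ^ 2 = n 0 ^ 2 + n 1 ^ 2 := by exact_mod_cast h1
    have : w n' ^ 2 = w n ^ 2 := by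
      simp only [w]
      linear_combination (p ^ 2 + q ^ 2) * h1' + (q * n 0 + p * n 1 + (q * n' 0 + p * n' 1)) * h2
    simpa using sq_eq_sq_iff_eq_or_eq_neg.mp this
  · intro x hx y hy hxy
    simp only [Finset.coe_filter, Set.mem_ofPred_eq] at hx hy
    have h : q * x 0 + p * x 1 = q * y 0 + p * y 1 := hx.2.symm.trans hy.2
    simp only [w] at hxy
    have h0 : (p ^ 2 + q ^ 2) * x 0 = (p ^ 2 + q ^ 2) * y 0 := by
      linear_combination q * h - p * hxy
    have h1 : (p ^ 2 + q ^ 2) * x 1 = (p ^ 2 + q ^ 2) * y 1 := by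
      linear_combination p * h + q * hxy
    funext i
    fin_cases i
    · exact mul_left_cancel₀ hpq.ne' h0
    · exact mul_left_cancel₀ hpq.ne' h1

theorem stmt2 :
    ∃ C : ℝ, 0 < C ∧
      ∀ (p q : ℤ), Int.gcd p q = 1 → q ≠ 0 → |p| ≤ |q| →
        ∀ (lam : ℝ), 1 ≤ lam →
          ∀ (E : Finset (Fin 2 → ℤ)),
            (∀ n : Fin 2 → ℤ, n ∈ E ↔ (∑ i, ((n i : ℝ)) ^ 2) = lam ^ 2) →
              ∀ (c : (Fin 2 → ℤ) → ℂ) (x₀ : Fin 2 → ℝ),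
                (∫ t in (0 : ℝ)..1,
                    ‖∑ n ∈ E, c n *
                      Complex.exp (Complex.I * (dotIR n (fun i =>
                        x₀ i + t * (![(q : ℝ), (p : ℝ)] i /
                          Real.sqrt ((p : ℝ) ^ 2 + (q : ℝ) ^ 2))) : ℂ))‖ ^ 2)
                  ≤ C * |(q : ℝ)| * ∑ n ∈ E, ‖c n‖ ^ 2 := by
  refine ⟨8 * Real.pi, by positivity, ?_⟩
  intro p q _ hq hpq lam _ E hE c x₀
  set s := Real.sqrt ((p : ℝ) ^ 2 + (q : ℝ) ^ 2) with hs
  have hq1 : (1 : ℝ) ≤ |(q : ℝ)| := by exact_mod_cast Int.one_le_abs hq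
  have hpq' : |(p : ℝ)| ≤ |(q : ℝ)| := by exact_mod_cast hpq
  have hp2 : (p : ℝ) ^ 2 ≤ (q : ℝ) ^ 2 := sq_le_sq.mpr hpq'
  have hs1 : 1 ≤ s := by
    apply Real.le_sqrt_of_sq_le
    nlinarith [sq_abs (q : ℝ), sq_nonneg (p : ℝ)]
  have hs2 : s ≤ 2 * |(q : ℝ)| := by
    apply Real.sqrt_le_iff.mpr
    constructor
    · positivity
    · nlinarith [sq_abs (q : ℝ), sq_nonneg (q : ℝ)]
  have hs0 : 0 < s := by linarith
  have key := aux_key E (fun n => c n * Complex.exp (((dotIR n x₀ : ℝ) : ℂ) * Complex.I))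
    (fun n => q * n 0 + p * n 1) s hs0 (by nlinarith [Real.pi_gt_three])
    (fun n hn => aux_card p q hq lam E hE n hn)
  simp only [norm_mul, Complex.norm_exp_ofReal_mul_I, mul_one] at key
  have hsc : (s : ℂ) ≠ 0 := by exact_mod_cast hs0.ne'
  refine le_trans (le_of_eq ?_) (key.trans ?_)
  · congr 1
    funext t
    congr 2
    refine Finset.sum_congr rfl fun n _ => ?_
    rw [mul_assoc, ← Complex.exp_add]
    congr 2
    simp only [dotIR, Fin.sum_univ_two, Matrix.cons_val_zero, Matrix.cons_val_one]
    push_cast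
    field_simp
    ring
  · have : 0 ≤ ∑ n ∈ E, ‖c n‖ ^ 2 := by positivity
    apply mul_le_mul_of_nonneg_right _ this
    nlinarith [Real.pi_pos]
end

section
/- Let d ≥ 3 and 1 ≤ k ≤ d−1. There exists a constant C = C(d,k) such that the following holds for every λ ≥ 2. Let a_{ij} ∈ ℝ with |a_{ij}| ≤ 1 for k+1 ≤ i ≤ d and 1 ≤ j ≤ k, set u_j = e_j + Σ_{i=k+1}^d a_{ij} e_i (where e_1,…,e_d is the standard basis of ℝ^d), and let Σ be the totally geodesic k-dimensional submanifold parametrized by x(t) = x₀ + Σ_{j=1}^k t_j u_j, t ∈ [−1,1]^k, with surface measure dσ = √(det[u_i·u_j]_{k×k}) dt. Then for every x₀ ∈ ℝ^d and every choice of complex coefficients (c_n)_{n∈E} with E = {n ∈ ℤ^d : |n| = λ}, one has ∫_{[−1,1]^k} |Σ_{n∈E} c_n e^{i n·x(t)}|² dσ ≤ C · A_{k,d,λ} · (log λ)^k · Σ_{n∈E} |c_n|². (Every k-dimensional totally geodesic submanifold of T^d is of this form after a permutation of the coordinates.) -/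
open MeasureTheory

/-- `A_{k,d,lam}`: the maximal number of points of `ℤ^d` in the intersection of
`k` unit bands of the sphere of radius `lam` in `ℝ^d` that are
`ν_{k,d}`-transverse, where `ν_{k,d} = (d-k+1)^(-k/2)`. -/
noncomputable def Akd (k d : ℕ) (lam : ℝ) : ℕ :=
  sSup {N : ℕ | ∃ (u x₀ : Fin k → Fin d → ℝ),
    (∀ j, u j ≠ 0) ∧
    (((d : ℝ) - k + 1) ^ (-(k : ℝ) / 2)) * ∏ j, Real.sqrt (∑ l, (u j l) ^ 2) ≤
      Real.sqrt (Matrix.det (Matrix.of fun i j : Fin k => ∑ l, u i l * u j l)) ∧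
    N = Set.ncard {n : Fin d → ℤ |
      (∑ i, ((n i : ℝ)) ^ 2) = lam ^ 2 ∧
      ∀ j, |∑ i, u j i * ((n i : ℝ) - x₀ j i)| ≤ Real.sqrt (∑ i, (u j i) ^ 2)}}

lemma aux_kernel (δ : ℝ) :
    ‖∫ t in Set.Icc (-1 : ℝ) 1, Complex.exp (Complex.I * ((t * δ : ℝ) : ℂ))‖ ≤ 4 / (1 + |δ|) := by
  rw [integral_Icc_eq_integral_Ioc, ← intervalIntegral.integral_of_le (by norm_num)]
  have h2 : ‖∫ t in (-1:ℝ)..1, Complex.exp (Complex.I * ((t * δ : ℝ) : ℂ))‖ ≤ 2 := by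
    have := intervalIntegral.norm_integral_le_of_norm_le_const (a := -1) (b := 1) (C := 1)
      (f := fun t : ℝ => Complex.exp (Complex.I * ((t * δ : ℝ) : ℂ))) (fun t _ => by
        rw [Complex.norm_exp_I_mul_ofReal])
    norm_num at this ⊢
    exact this
  rw [le_div_iff₀ (by positivity)]
  by_cases h1 : |δ| ≤ 1
  · nlinarith [norm_nonneg (∫ t in (-1:ℝ)..1, Complex.exp (Complex.I * ((t * δ : ℝ) : ℂ))), abs_nonneg δ]
  · have hδ : δ ≠ 0 := by rintro rfl; simp at h1
    have hc : Complex.I * (δ : ℂ) ≠ 0 := mul_ne_zero Complex.I_ne_zero (by exact_mod_cast hδ)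
    have e : (fun t : ℝ => Complex.exp (Complex.I * ((t * δ : ℝ) : ℂ)))
        = fun t : ℝ => Complex.exp (Complex.I * (δ : ℂ) * t) := by
      funext t; congr 1; push_cast; ring
    have h3 : ‖∫ t in (-1:ℝ)..1, Complex.exp (Complex.I * ((t * δ : ℝ) : ℂ))‖ * |δ| ≤ 2 := by
      rw [e, integral_exp_mul_complex hc, norm_div, norm_mul, Complex.norm_I, one_mul,
        Complex.norm_real, Real.norm_eq_abs, div_mul_cancel₀ _ (by simpa using hδ)]
      refine (norm_sub_le _ _).trans ?_
      have q : ∀ s : ℝ, ‖Complex.exp (Complex.I * (δ : ℂ) * (s : ℂ))‖ = 1 := by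
        intro s
        rw [mul_assoc, ← Complex.ofReal_mul, Complex.norm_exp_I_mul_ofReal]
      rw [q, q]; norm_num
    linarith

lemma aux_box {k : ℕ} (δ : Fin k → ℝ) :
    ‖∫ t in Set.univ.pi (fun _ : Fin k => Set.Icc (-1 : ℝ) 1),
      Complex.exp (Complex.I * ((∑ j, t j * δ j : ℝ) : ℂ))‖ ≤ ∏ j, (4 / (1 + |δ j|)) := by
  have e : (fun t : Fin k → ℝ => Complex.exp (Complex.I * ((∑ j, t j * δ j : ℝ) : ℂ)))
      = fun t => ∏ j, (fun j (s : ℝ) => Complex.exp (Complex.I * ((s * δ j : ℝ) : ℂ))) j (t j) := by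
    funext t
    rw [← Complex.exp_sum]
    congr 1; push_cast; rw [Finset.mul_sum]
  rw [e, volume_pi, Measure.restrict_pi_pi, integral_fintype_prod_eq_prod
    (fun j (s : ℝ) => Complex.exp (Complex.I * ((s * δ j : ℝ) : ℂ))), norm_prod]
  exact Finset.prod_le_prod (fun _ _ => norm_nonneg _) (fun j _ => aux_kernel (δ j))

lemma aux_energy {α : Type*} {k : ℕ} (E : Finset α) (b : α → ℂ) (m : α → Fin k → ℝ) :
    (∫ t in Set.univ.pi (fun _ : Fin k => Set.Icc (-1 : ℝ) 1),
      ‖∑ n ∈ E, b n * Complex.exp (Complex.I * ((∑ j, t j * m n j : ℝ) : ℂ))‖ ^ 2)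
    ≤ ∑ n ∈ E, ∑ n' ∈ E, ‖b n‖ * ‖b n'‖ * ∏ j, (4 / (1 + |m n j - m n' j|)) := by
  set S := Set.univ.pi (fun _ : Fin k => Set.Icc (-1 : ℝ) 1) with hS
  have hcomp : IsCompact S := isCompact_univ_pi (fun _ => isCompact_Icc)
  have e : ∀ t : Fin k → ℝ,
      ((‖∑ n ∈ E, b n * Complex.exp (Complex.I * ((∑ j, t j * m n j : ℝ) : ℂ))‖ ^ 2 : ℝ) : ℂ)
      = ∑ n ∈ E, ∑ n' ∈ E, b n * (starRingEnd ℂ) (b n') *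
        Complex.exp (Complex.I * ((∑ j, t j * (m n j - m n' j) : ℝ) : ℂ)) := by
    intro t
    rw [Complex.ofReal_pow, ← Complex.mul_conj', map_sum, Finset.sum_mul_sum]
    refine Finset.sum_congr rfl fun n _ => Finset.sum_congr rfl fun n' _ => ?_
    rw [map_mul, ← Complex.exp_conj, map_mul, Complex.conj_I, Complex.conj_ofReal]
    rw [mul_mul_mul_comm, ← Complex.exp_add]
    congr 2
    simp only [mul_sub, Finset.sum_sub_distrib]
    push_cast; ring
  have hint : ∀ n n', IntegrableOn (fun t : Fin k → ℝ => b n * (starRingEnd ℂ) (b n') *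
        Complex.exp (Complex.I * ((∑ j, t j * (m n j - m n' j) : ℝ) : ℂ))) S := by
    intro n n'
    refine ContinuousOn.integrableOn_compact hcomp (Continuous.continuousOn ?_)
    fun_prop
  have h1 : ((∫ t in S, ‖∑ n ∈ E, b n * Complex.exp (Complex.I * ((∑ j, t j * m n j : ℝ) : ℂ))‖ ^ 2 : ℝ) : ℂ)
      = ∑ n ∈ E, ∑ n' ∈ E, b n * (starRingEnd ℂ) (b n') *
        ∫ t in S, Complex.exp (Complex.I * ((∑ j, t j * (m n j - m n' j) : ℝ) : ℂ)) := by
    rw [← integral_complex_ofReal]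
    simp_rw [e]
    rw [integral_finsetSum _ (fun n _ => integrable_finsetSum _ (fun n' _ => hint n n'))]
    refine Finset.sum_congr rfl fun n _ => ?_
    rw [integral_finsetSum _ (fun n' _ => hint n n')]
    refine Finset.sum_congr rfl fun n' _ => ?_
    rw [integral_const_mul]
  refine (le_abs_self _).trans ?_
  rw [← Real.norm_eq_abs, ← Complex.norm_real, h1]
  refine (norm_sum_le _ _).trans (Finset.sum_le_sum fun n _ => ?_)
  refine (norm_sum_le _ _).trans (Finset.sum_le_sum fun n' _ => ?_)
  rw [norm_mul, norm_mul, RCLike.norm_conj]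
  exact mul_le_mul_of_nonneg_left (aux_box _) (by positivity)

lemma aux_schur_s4 {α : Type*} (E : Finset α) (x : α → ℝ) (K : α → α → ℝ)
    (hK : ∀ n n', 0 ≤ K n n') (hs : ∀ n n', K n n' = K n' n) (B : ℝ)
    (hB : ∀ n ∈ E, ∑ n' ∈ E, K n n' ≤ B) :
    ∑ n ∈ E, ∑ n' ∈ E, x n * x n' * K n n' ≤ B * ∑ n ∈ E, x n ^ 2 := by
  have h1 : ∑ n ∈ E, ∑ n' ∈ E, x n * x n' * K n n' ≤
      ∑ n ∈ E, ∑ n' ∈ E, (x n ^ 2 / 2 * K n n' + x n' ^ 2 / 2 * K n n') := by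
    refine Finset.sum_le_sum fun n _ => Finset.sum_le_sum fun n' _ => ?_
    rw [← add_mul]
    refine mul_le_mul_of_nonneg_right ?_ (hK _ _)
    nlinarith [sq_nonneg (x n - x n')]
  have h2 : ∑ n ∈ E, ∑ n' ∈ E, x n ^ 2 / 2 * K n n' ≤ B * ∑ n ∈ E, x n ^ 2 / 2 := by
    rw [Finset.mul_sum]
    refine Finset.sum_le_sum fun n hn => ?_
    rw [← Finset.mul_sum, mul_comm B]
    exact mul_le_mul_of_nonneg_left (hB n hn) (by positivity)
  have h3 : ∑ n ∈ E, ∑ n' ∈ E, x n' ^ 2 / 2 * K n n' = ∑ n ∈ E, ∑ n' ∈ E, x n ^ 2 / 2 * K n n' := by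
    rw [Finset.sum_comm]
    exact Finset.sum_congr rfl fun n _ => Finset.sum_congr rfl fun n' _ => by rw [hs]
  have h4 : ∑ n ∈ E, x n ^ 2 / 2 = (∑ n ∈ E, x n ^ 2) / 2 := by rw [Finset.sum_div]
  simp only [Finset.sum_add_distrib] at h1
  rw [h3] at h1
  rw [h4] at h2
  linarith

lemma aux_row_s4 {α : Type*} [DecidableEq α] {k : ℕ} (E : Finset α) (δ : α → Fin k → ℝ) (A M : ℕ)
    (hA : ∀ z : Fin k → ℤ, (E.filter (fun n => (fun j => ⌊δ n j⌋) = z)).card ≤ A)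
    (hM : ∀ n ∈ E, ∀ j, |δ n j| ≤ M) :
    ∑ n ∈ E, ∏ j, (4 / (1 + |δ n j|)) ≤
      A * (∑ z ∈ Finset.Icc (-(M:ℤ)) M, 8 / (1 + |(z:ℝ)|)) ^ k := by
  have hmap : ∀ n ∈ E, (fun j => ⌊δ n j⌋) ∈
      Fintype.piFinset (fun _ : Fin k => Finset.Icc (-(M:ℤ)) M) := by
    intro n hn
    rw [Fintype.mem_piFinset]
    intro j
    have := abs_le.1 (hM n hn j)
    rw [Finset.mem_Icc]
    constructor
    · rw [Int.le_floor]; push_cast; exact this.1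
    · have := (Int.floor_le (δ n j)).trans this.2
      exact_mod_cast this
  rw [← Finset.sum_fiberwise_of_maps_to hmap]
  have : (∑ z ∈ Finset.Icc (-(M:ℤ)) M, 8 / (1 + |(z:ℝ)|)) ^ k
      = ∏ j : Fin k, (∑ z ∈ Finset.Icc (-(M:ℤ)) M, 8 / (1 + |(z:ℝ)|)) := by simp
  rw [this, Finset.prod_univ_sum, Finset.mul_sum]
  refine Finset.sum_le_sum fun z _ => ?_
  have hb : ∀ n ∈ E.filter (fun n => (fun j => ⌊δ n j⌋) = z),
      ∏ j, (4 / (1 + |δ n j|)) ≤ ∏ j, 8 / (1 + |(z j:ℝ)|) := by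
    intro n hn
    have hz := (Finset.mem_filter.1 hn).2
    refine Finset.prod_le_prod (fun _ _ => by positivity) (fun j _ => ?_)
    have hzj : ⌊δ n j⌋ = z j := congrFun hz j
    have l1 := Int.floor_le (δ n j)
    have l2 := Int.lt_floor_add_one (δ n j)
    rw [hzj] at l1 l2
    have : |(z j : ℝ)| ≤ |δ n j| + 1 := by
      rw [abs_le]; constructor
      · linarith [neg_abs_le (δ n j)]
      · linarith [le_abs_self (δ n j)]
    rw [div_le_div_iff₀ (by positivity) (by positivity)]
    linarith [abs_nonneg (δ n j)]
  refine (Finset.sum_le_card_nsmul _ _ _ hb).trans ?_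
  rw [nsmul_eq_mul]
  refine mul_le_mul_of_nonneg_right (by exact_mod_cast hA z) ?_
  exact Finset.prod_nonneg fun _ _ => by positivity

lemma aux_harm (M : ℕ) : ∑ z ∈ Finset.Icc (-(M:ℤ)) M, 8 / (1 + |(z:ℝ)|) ≤ 16 * (1 + Real.log (M + 1)) := by
  have h1 : ∑ z ∈ Finset.Icc (-(M:ℤ)) M, 8 / (1 + |(z:ℝ)|) ≤ 16 * (harmonic (M+1) : ℝ) := by
    induction M with
    | zero => simp [harmonic]; norm_num
    | succ M ih =>
      have : Finset.Icc (-((M+1:ℕ):ℤ)) ((M+1:ℕ):ℤ) =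
          insert (-((M:ℤ)+1)) (insert ((M:ℤ)+1) (Finset.Icc (-(M:ℤ)) M)) := by
        ext z; simp only [Finset.mem_Icc, Finset.mem_insert]; push_cast; omega
      rw [this, Finset.sum_insert, Finset.sum_insert, harmonic_succ (M+1)]
      · push_cast
        have e : |(M:ℝ)+1| = M + 1 := abs_of_nonneg (by positivity)
        rw [abs_neg, e]
        have : 8 / (1 + ((M:ℝ)+1)) = 8 * ((M:ℝ)+1+1)⁻¹ := by rw [div_eq_mul_inv]; ring_nf
        rw [this]; linarith
      · simp
      · simp only [Finset.mem_Icc, Finset.mem_insert]; omega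
  refine h1.trans ?_
  have := harmonic_le_one_add_log (M+1)
  push_cast at this
  linarith

lemma aux_det {k : ℕ} {P : Matrix (Fin k) (Fin k) ℝ} (hP : P.PosSemidef) : 1 ≤ (1 + P).det := by
  have hM : (1 + P).IsHermitian := Matrix.isHermitian_one.add hP.1
  rw [hM.det_eq_prod_eigenvalues]
  have : ∀ i ∈ Finset.univ, (1:ℝ) ≤ ((hM.eigenvalues i : ℝ)) := by
    intro i _
    rw [hM.eigenvalues_eq, Matrix.add_mulVec, Matrix.one_mulVec, dotProduct_add]
    have h1 := hP.dotProduct_mulVec_nonneg (hM.eigenvectorBasis i).ofLp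
    have h2 : star (hM.eigenvectorBasis i).ofLp ⬝ᵥ (hM.eigenvectorBasis i).ofLp = 1 := by
      have h3 := hM.eigenvectorBasis.orthonormal.1 i
      have h4 := real_inner_self_eq_norm_sq (hM.eigenvectorBasis i)
      rw [h3] at h4
      rw [dotProduct_comm, ← EuclideanSpace.inner_eq_star_dotProduct, h4, one_pow]
    rw [h2]
    simpa using h1
  have := Finset.prod_le_prod (fun i _ => zero_le_one) this
  simpa using this

lemma aux_gram {d k : ℕ} (hk : k ≤ d) (u : Fin k → Fin d → ℝ)
    (hu : ∀ (j : Fin k) (i : Fin d),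
            (i.val < k → u j i = if i.val = j.val then 1 else 0) ∧
            (k ≤ i.val → |u j i| ≤ 1)) :
    1 ≤ Matrix.det (Matrix.of fun i j : Fin k => ∑ l, u i l * u j l) := by
  set B : Matrix (Fin k) (Fin d) ℝ := Matrix.of fun j i => if i.val < k then 0 else u j i with hB
  have hP := Matrix.posSemidef_self_mul_conjTranspose B
  have e : (Matrix.of fun i j : Fin k => ∑ l, u i l * u j l) = 1 + B * B.conjTranspose := by
    ext i j
    rw [Matrix.add_apply, Matrix.mul_apply, Matrix.of_apply]
    have h1 : (1 : Matrix (Fin k) (Fin k) ℝ) i j =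
        ∑ l : Fin d, if l = Fin.castLE hk i then (1 : Matrix (Fin k) (Fin k) ℝ) i j else 0 := by
      simp
    rw [h1, ← Finset.sum_add_distrib]
    refine Finset.sum_congr rfl fun l _ => ?_
    simp only [hB, Matrix.conjTranspose_apply, Matrix.of_apply, star_trivial]
    by_cases hl : l.val < k
    · rw [(hu i l).1 hl, (hu j l).1 hl]
      simp only [hl, if_true, Matrix.one_apply, Fin.ext_iff, Fin.val_castLE]
      by_cases h2 : l.val = i.val
      · simp [h2]
      · simp [h2]
    · have : l ≠ Fin.castLE hk i := by
        rintro rfl; simp at hl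
      simp [hl, this]
  rw [e]
  exact aux_det hP

lemma aux_norm {d k : ℕ} (hk : k ≤ d) (u : Fin k → Fin d → ℝ)
    (hu : ∀ (j : Fin k) (i : Fin d),
            (i.val < k → u j i = if i.val = j.val then 1 else 0) ∧
            (k ≤ i.val → |u j i| ≤ 1)) (j : Fin k) :
    1 ≤ ∑ l, (u j l) ^ 2 ∧ ∑ l, (u j l) ^ 2 ≤ (d : ℝ) - k + 1 := by
  constructor
  · have h := Finset.single_le_sum (f := fun l => (u j l)^2) (s := Finset.univ)
      (fun _ _ => sq_nonneg _) (Finset.mem_univ (Fin.castLE hk j))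
    have h2 : u j (Fin.castLE hk j) = 1 := by
      rw [(hu j _).1 (by simp)]; simp
    simp only [h2] at h
    linarith
  · obtain ⟨r, rfl⟩ := Nat.exists_eq_add_of_le hk
    rw [Fin.sum_univ_add]
    have h1 : ∑ i : Fin k, (u j (Fin.castAdd r i)) ^ 2 = 1 := by
      rw [Finset.sum_eq_single j]
      · rw [(hu j _).1 (by simp)]; simp
      · intro b _ hb
        rw [(hu j _).1 (by simp)]
        simp [Fin.val_inj, hb]
      · simp
    have h2 : ∑ i : Fin r, (u j (Fin.natAdd k i)) ^ 2 ≤ ∑ i : Fin r, (1:ℝ) := by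
      refine Finset.sum_le_sum fun i _ => ?_
      have := (hu j (Fin.natAdd k i)).2 (by simp)
      rwa [sq_le_one_iff_abs_le_one]
    rw [h1]
    simp at h2
    push_cast
    linarith

lemma aux_le_Akd {d k : ℕ} (hk : k ≤ d) (lam : ℝ) (u : Fin k → Fin d → ℝ)
    (hu : ∀ (j : Fin k) (i : Fin d),
            (i.val < k → u j i = if i.val = j.val then 1 else 0) ∧
            (k ≤ i.val → |u j i| ≤ 1))
    (E : Finset (Fin d → ℤ))
    (hE : ∀ n : Fin d → ℤ, n ∈ E ↔ (∑ i, ((n i : ℝ)) ^ 2) = lam ^ 2)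
    (x₀ : Fin k → Fin d → ℝ) (F : Finset (Fin d → ℤ)) (hFE : F ⊆ E)
    (hF : ∀ n ∈ F, ∀ j, |∑ i, u j i * ((n i : ℝ) - x₀ j i)| ≤ 1) : F.card ≤ Akd k d lam := by
  have hsub : ∀ (u x₀ : Fin k → Fin d → ℝ), {n : Fin d → ℤ |
      (∑ i, ((n i : ℝ)) ^ 2) = lam ^ 2 ∧
      ∀ j, |∑ i, u j i * ((n i : ℝ) - x₀ j i)| ≤ Real.sqrt (∑ i, (u j i) ^ 2)} ⊆ (E : Set (Fin d → ℤ)) := by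
    intro u x₀ n hn
    exact (hE n).2 hn.1
  have hle : F.card ≤ Set.ncard {n : Fin d → ℤ |
      (∑ i, ((n i : ℝ)) ^ 2) = lam ^ 2 ∧
      ∀ j, |∑ i, u j i * ((n i : ℝ) - x₀ j i)| ≤ Real.sqrt (∑ i, (u j i) ^ 2)} := by
    rw [← Set.ncard_coe_finset]
    refine Set.ncard_le_ncard ?_ (E.finite_toSet.subset (hsub u x₀))
    intro n hn
    refine ⟨(hE n).1 (hFE hn), fun j => (hF n hn j).trans ?_⟩
    rw [Real.one_le_sqrt]
    exact (aux_norm hk u hu j).1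
  refine hle.trans (le_csSup ?_ ?_)
  · refine ⟨E.card, ?_⟩
    rintro N ⟨u, x₀, -, -, rfl⟩
    rw [← Set.ncard_coe_finset]
    exact Set.ncard_le_ncard (hsub u x₀) E.finite_toSet
  · refine ⟨u, x₀, ?_, ?_, rfl⟩
    · intro j h0
      have := (aux_norm hk u hu j).1
      simp [h0] at this
      linarith
    · have h1 : 1 ≤ Real.sqrt (Matrix.det (Matrix.of fun i j : Fin k => ∑ l, u i l * u j l)) := by
        rw [Real.one_le_sqrt]; exact aux_gram hk u hu
      refine le_trans ?_ h1
      have hpos : (0:ℝ) < (d : ℝ) - k + 1 := by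
        have : (k:ℝ) ≤ d := by exact_mod_cast hk
        linarith
      have h2 : ∏ j, Real.sqrt (∑ l, (u j l) ^ 2) ≤ ((d : ℝ) - k + 1) ^ ((k : ℝ) / 2) := by
        calc ∏ j, Real.sqrt (∑ l, (u j l) ^ 2) ≤ ∏ j : Fin k, Real.sqrt ((d : ℝ) - k + 1) :=
              Finset.prod_le_prod (fun _ _ => Real.sqrt_nonneg _)
                (fun j _ => Real.sqrt_le_sqrt (aux_norm hk u hu j).2)
          _ = ((d : ℝ) - k + 1) ^ ((k : ℝ) / 2) := by
            rw [Finset.prod_const, Finset.card_univ, Fintype.card_fin, Real.sqrt_eq_rpow,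
              ← Real.rpow_natCast, ← Real.rpow_mul hpos.le]
            congr 1; ring
      calc _ ≤ ((d : ℝ) - k + 1) ^ (-(k : ℝ) / 2) * ((d : ℝ) - k + 1) ^ ((k : ℝ) / 2) :=
            mul_le_mul_of_nonneg_left h2 (by positivity)
        _ = 1 := by
            rw [← Real.rpow_add hpos]
            have : -(k:ℝ)/2 + k/2 = 0 := by ring
            rw [this, Real.rpow_zero]

lemma aux_u {d k : ℕ} (u : Fin k → Fin d → ℝ)
    (hu : ∀ (j : Fin k) (i : Fin d),
            (i.val < k → u j i = if i.val = j.val then 1 else 0) ∧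
            (k ≤ i.val → |u j i| ≤ 1)) (j : Fin k) (i : Fin d) : |u j i| ≤ 1 := by
  by_cases h : i.val < k
  · rw [(hu j i).1 h]; split_ifs <;> simp
  · exact (hu j i).2 (by omega)

lemma aux_log (d M : ℕ) (lam : ℝ) (hl : 2 ≤ lam) (hM : (M:ℝ) ≤ 2 * d * lam + 1) :
    16 * (1 + Real.log (M + 1)) ≤
      16 * ((1 + Real.log (2 * d + 1)) / Real.log 2 + 1) * Real.log lam := by
  have h1 : Real.log (M + 1) ≤ Real.log ((2 * d + 1) * lam) := by
    apply Real.log_le_log (by positivity)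
    linarith
  rw [Real.log_mul (by positivity) (by positivity)] at h1
  have hlog2 : 0 < Real.log 2 := Real.log_pos (by norm_num)
  have h2 : Real.log 2 ≤ Real.log lam := Real.log_le_log (by norm_num) hl
  have h3 : 0 ≤ Real.log (2 * d + 1) := Real.log_nonneg (by linarith [Nat.cast_nonneg (α := ℝ) d])
  have h4 : 1 + Real.log (2 * d + 1) ≤ (1 + Real.log (2 * d + 1)) / Real.log 2 * Real.log lam := by
    rw [div_mul_eq_mul_div, le_div_iff₀ hlog2]
    exact mul_le_mul_of_nonneg_left h2 (by linarith)
  nlinarith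

theorem stmt4 (d k : ℕ) (hd : 3 ≤ d) (hk1 : 1 ≤ k) (hk2 : k ≤ d - 1) :
    ∃ C : ℝ, 0 < C ∧
      ∀ (lam : ℝ), 2 ≤ lam →
        ∀ (u : Fin k → Fin d → ℝ),
          (∀ (j : Fin k) (i : Fin d),
            (i.val < k → u j i = if i.val = j.val then 1 else 0) ∧
            (k ≤ i.val → |u j i| ≤ 1)) →
          ∀ (E : Finset (Fin d → ℤ)),
            (∀ n : Fin d → ℤ, n ∈ E ↔ (∑ i, ((n i : ℝ)) ^ 2) = lam ^ 2) →
              ∀ (c : (Fin d → ℤ) → ℂ) (x₀ : Fin d → ℝ),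
                Real.sqrt (Matrix.det (Matrix.of fun i j : Fin k => ∑ l, u i l * u j l)) *
                  (∫ t in Set.univ.pi (fun _ : Fin k => Set.Icc (-1 : ℝ) 1),
                    ‖∑ n ∈ E, c n *
                      Complex.exp (Complex.I * (dotIR n (fun i =>
                        x₀ i + ∑ j, t j * u j i) : ℂ))‖ ^ 2)
                  ≤ C * (Akd k d lam) * (Real.log lam) ^ k * ∑ n ∈ E, ‖c n‖ ^ 2 := by
  have hk : k ≤ d := by omega
  have hlog2 : 0 < Real.log 2 := Real.log_pos (by norm_num)
  have hlogd : 0 ≤ Real.log (2 * d + 1) := Real.log_nonneg (by linarith [Nat.cast_nonneg (α := ℝ) d])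
  have hd0 : (0:ℝ) < d := by exact_mod_cast (by omega : 0 < d)
  set Q : ℝ := 16 * ((1 + Real.log (2 * d + 1)) / Real.log 2 + 1) with hQ
  have hQ0 : 0 < Q := by positivity
  set D : ℝ := Real.sqrt ((k.factorial : ℝ) * (d:ℝ) ^ k) with hD
  have hD0 : 0 < D := Real.sqrt_pos.2 (by positivity)
  refine ⟨D * Q ^ k, by positivity, ?_⟩
  intro lam hl u hu E hE c x₀
  have hlam : 0 ≤ Real.log lam := Real.log_nonneg (by linarith)
  -- determinant bound
  have hdet : Real.sqrt (Matrix.det (Matrix.of fun i j : Fin k => ∑ l, u i l * u j l)) ≤ D := by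
    refine Real.sqrt_le_sqrt ((le_abs_self _).trans ?_)
    have := Matrix.det_le (A := Matrix.of fun i j : Fin k => ∑ l, u i l * u j l)
      (abv := AbsoluteValue.abs) (x := (d:ℝ)) (fun i j => by
        simp only [Matrix.of_apply, AbsoluteValue.abs_apply]
        refine (Finset.abs_sum_le_sum_abs _ _).trans ?_
        calc ∑ l, |u i l * u j l| ≤ ∑ l : Fin d, (1:ℝ) := by
              refine Finset.sum_le_sum fun l _ => ?_
              rw [abs_mul]
              exact mul_le_one₀ (aux_u u hu i l) (abs_nonneg _) (aux_u u hu j l)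
          _ = d := by simp)
    simpa using this
  set m : (Fin d → ℤ) → Fin k → ℝ := fun n j => ∑ i, (n i : ℝ) * u j i with hm
  have hmb : ∀ n ∈ E, ∀ j, |m n j| ≤ d * lam := by
    intro n hn j
    refine (Finset.abs_sum_le_sum_abs _ _).trans ?_
    calc ∑ i, |(n i : ℝ) * u j i| ≤ ∑ i : Fin d, lam := by
          refine Finset.sum_le_sum fun i _ => ?_
          have h1 : |(n i : ℝ)| ≤ lam := by
            refine abs_le_of_sq_le_sq ?_ (by linarith)
            rw [← (hE n).1 hn]
            exact Finset.single_le_sum (f := fun i => ((n i : ℝ)) ^ 2) (fun _ _ => sq_nonneg _)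
              (Finset.mem_univ i)
          rw [abs_mul]
          calc |(n i : ℝ)| * |u j i| ≤ |(n i : ℝ)| * 1 :=
                mul_le_mul_of_nonneg_left (aux_u u hu j i) (abs_nonneg _)
            _ ≤ lam := by linarith
      _ = d * lam := by simp
  have hexp : ∀ t : Fin k → ℝ, (∑ n ∈ E, c n *
                      Complex.exp (Complex.I * (dotIR n (fun i =>
                        x₀ i + ∑ j, t j * u j i) : ℂ)))
      = ∑ n ∈ E, (c n * Complex.exp (Complex.I * (dotIR n x₀ : ℂ))) *
          Complex.exp (Complex.I * ((∑ j, t j * m n j : ℝ) : ℂ)) := by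
    intro t
    refine Finset.sum_congr rfl fun n _ => ?_
    rw [mul_assoc, ← Complex.exp_add, ← mul_add, ← Complex.ofReal_add]
    congr 4
    simp only [dotIR, hm, mul_add, Finset.sum_add_distrib, Finset.mul_sum]
    congr 1
    rw [Finset.sum_comm]
    refine Finset.sum_congr rfl fun j _ => Finset.sum_congr rfl fun i _ => by ring
  simp_rw [hexp]
  have hen := aux_energy E (fun n => c n * Complex.exp (Complex.I * (dotIR n x₀ : ℂ))) m
  simp only [norm_mul (c _), Complex.norm_exp_I_mul_ofReal, mul_one] at hen
  set M : ℕ := ⌈2 * d * lam⌉₊ with hMdef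
  have hM1 : 2 * d * lam ≤ M := Nat.le_ceil _
  have hM2 : (M:ℝ) ≤ 2 * d * lam + 1 := (Nat.ceil_lt_add_one (by positivity)).le
  have hrow : ∀ n ∈ E, ∑ n' ∈ E, ∏ j, (4 / (1 + |m n j - m n' j|)) ≤
      Akd k d lam * (Q * Real.log lam) ^ k := by
    intro n hn
    have h1 := aux_row_s4 E (fun n' j => m n' j - m n j) (Akd k d lam) M ?_ ?_
    · simp only [abs_sub_comm (m n _)]
      refine h1.trans (mul_le_mul_of_nonneg_left ?_ (by positivity))
      refine pow_le_pow_left₀ (Finset.sum_nonneg fun _ _ => by positivity) ?_ k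
      exact (aux_harm M).trans (aux_log d M lam hl hM2)
    · intro z
      refine aux_le_Akd hk lam u hu E hE
        (fun j i => (n i : ℝ) + if i = Fin.castLE hk j then (z j : ℝ) else 0) _
        (Finset.filter_subset _ _) ?_
      intro n' hn' j
      have hz : ⌊m n' j - m n j⌋ = z j := congrFun (Finset.mem_filter.1 hn').2 j
      have hujj : u j (Fin.castLE hk j) = 1 := by
        rw [(hu j _).1 (by simp)]; simp
      have e : ∑ i, u j i * ((n' i : ℝ) - ((n i : ℝ) + if i = Fin.castLE hk j then (z j : ℝ) else 0))
          = (m n' j - m n j) - z j := by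
        simp only [mul_sub, mul_add, mul_ite, mul_zero, Finset.sum_sub_distrib,
          Finset.sum_add_distrib, Finset.sum_ite_eq', Finset.mem_univ, if_true, hujj, one_mul, hm]
        simp only [mul_comm (u j _)]
        ring
      rw [e, abs_le]
      have l1 := Int.floor_le (m n' j - m n j)
      have l2 := Int.lt_floor_add_one (m n' j - m n j)
      rw [hz] at l1 l2
      constructor <;> linarith
    · intro n' hn' j
      refine (abs_sub _ _).trans ?_
      linarith [hmb n hn j, hmb n' hn' j]
  have hsch := aux_schur_s4 E (fun n => ‖c n‖) (fun n n' => ∏ j, (4 / (1 + |m n j - m n' j|)))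
    (fun n n' => Finset.prod_nonneg fun _ _ => by positivity)
    (fun n n' => Finset.prod_congr rfl fun j _ => by rw [abs_sub_comm]) _ hrow
  have hfin := hen.trans hsch
  refine (mul_le_mul hdet hfin (integral_nonneg fun _ => by positivity) hD0.le).trans (le_of_eq ?_)
  rw [mul_pow]; ring
end

section
/- Let d ≥ 3 and 1 ≤ k ≤ d−1. There exist constants c, C > 0 depending only on d and k such that for every λ ≥ 1 with {n ∈ ℤ^d : |n| = λ} ≠ ∅, there exist vectors u_1,…,u_k ∈ ℝ^d of the form u_j = e_j + Σ_{i=k+1}^d a_{ij} e_i with |a_{ij}| ≤ 1, and complex coefficients (c_n)_{n∈E} with Σ_{n∈E} |c_n|² = 1 (E = {n ∈ ℤ^d : |n| = λ}), such that c · A_{k,d,λ} ≤ ∫_{[−1,1]^k} |Σ_{n∈E} c_n e^{i n·(Σ_j t_j u_j)}|² √(det[u_i·u_j]_{k×k}) dt ≤ C · A_{k,d,λ}. In particular the bound ‖e_λ‖_{L²(Σ)} ≲ √(A_{k,d,λ}) (log λ)^{k/2} ‖e_λ‖_{L²(T^d)} is essentially sharp. -/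
open MeasureTheory

theorem aux_det_expand {k d : ℕ} (U : Matrix (Fin k) (Fin d) ℝ) :
    (U * U.transpose).det = ∑ p : Fin k → Fin d, (∏ i, U i (p i)) * (U.submatrix id p).det := by
  have h1 : (U * U.transpose).det
      = (Matrix.detRowAlternating (R := ℝ) (n := Fin k)).toMultilinearMap
          (fun i => ∑ l, U i l • (fun j => U j l)) := by
    show Matrix.det _ = Matrix.det _
    congr 1
    ext i j
    simp [Matrix.mul_apply, Finset.sum_apply]
  rw [h1, MultilinearMap.map_sum]
  refine Finset.sum_congr rfl fun p _ => ?_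
  rw [MultilinearMap.map_smul_univ, smul_eq_mul]
  congr 1
  rw [← Matrix.det_transpose]
  rfl

theorem aux_alg {k d : ℕ} (hd : 0 < d) (ν : ℝ) (hν : 0 < ν) (U : Matrix (Fin k) (Fin d) ℝ)
    (hU : ∀ i j, |U i j| ≤ 1) (hdet : ν ≤ (U * U.transpose).det) :
    ∃ (M : Matrix (Fin k) (Fin k) ℝ) (p : Fin k → Fin d), Function.Injective p ∧
      (∀ j i, (M * U) j (p i) = if i = j then 1 else 0) ∧
      (∀ j i, |(M * U) j i| ≤ 1) ∧
      (∀ j l, |M j l| ≤ (k.factorial : ℝ) * ((d : ℝ) ^ k / ν)) ∧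
      ν / (k.factorial : ℝ) ^ 2 ≤ ((M * U) * (M * U).transpose).det := by
  have : Nonempty (Fin d) := ⟨⟨0, hd⟩⟩
  obtain ⟨p, hp⟩ := Finite.exists_max (fun p : Fin k → Fin d => |(U.submatrix id p).det|)
  set W := U.submatrix id p with hW
  have hdpos : (0:ℝ) < (d:ℝ) ^ k := by positivity
  have h1 : ν ≤ (d:ℝ) ^ k * |W.det| := by
    refine hdet.trans ?_
    rw [aux_det_expand]
    refine (le_abs_self _).trans ((Finset.abs_sum_le_sum_abs _ _).trans ?_)
    have : ∀ q ∈ (Finset.univ : Finset (Fin k → Fin d)),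
        |(∏ i, U i (q i)) * (U.submatrix id q).det| ≤ |W.det| := by
      intro q _
      rw [abs_mul, Finset.abs_prod]
      have : ∏ i, |U i (q i)| ≤ 1 := Finset.prod_le_one (fun _ _ => abs_nonneg _) (fun i _ => hU _ _)
      calc _ ≤ 1 * |(U.submatrix id q).det| := by gcongr
        _ ≤ _ := by rw [one_mul]; exact hp q
    refine (Finset.sum_le_sum this).trans ?_
    simp
  have hWlow : ν / (d:ℝ) ^ k ≤ |W.det| := by
    rw [div_le_iff₀ hdpos]; linarith
  have hWpos : 0 < |W.det| := lt_of_lt_of_le (by positivity) hWlow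
  have hW0 : W.det ≠ 0 := abs_pos.mp hWpos
  have hWe : ∀ i j, |W i j| ≤ 1 := fun i j => hU _ _
  have hdetle : ∀ A : Matrix (Fin k) (Fin k) ℝ, (∀ i j, |A i j| ≤ 1) → |A.det| ≤ k.factorial := by
    intro A hA
    have := Matrix.det_le (abv := AbsoluteValue.abs) (A := A) (x := (1:ℝ)) (by simpa using hA)
    simpa using this
  have hMU : ∀ j i, (W⁻¹ * U) j i = (W.det)⁻¹ * (U.submatrix id (Function.update p j i)).det := by
    intro j i
    rw [Matrix.inv_def, Ring.inverse_eq_inv', Matrix.smul_mul, Matrix.smul_apply, smul_eq_mul]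
    congr 1
    have : (W.adjugate * U) j i = (W.adjugate.mulVec (fun l => U l i)) j := rfl
    rw [this, ← Matrix.cramer_eq_adjugate_mulVec, Matrix.cramer_apply]
    congr 1
    ext a b
    by_cases hb : b = j
    · subst hb; simp
    · simp [hb, hW]
  refine ⟨W⁻¹, p, ?_, ?_, ?_, ?_, ?_⟩
  · intro a b hab
    by_contra hne
    exact hW0 (Matrix.det_zero_of_column_eq hne (fun i => by simp [hW, hab]))
  · intro j i
    have : (W⁻¹ * U) j (p i) = (W⁻¹ * W) j i := rfl
    rw [this, Matrix.nonsing_inv_mul _ (isUnit_iff_ne_zero.mpr hW0), Matrix.one_apply]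
    simp [eq_comm]
  · intro j i
    rw [hMU, abs_mul, abs_inv, inv_mul_le_iff₀ hWpos, mul_one]
    exact hp _
  · intro j l
    rw [Matrix.inv_def, Ring.inverse_eq_inv', Matrix.smul_apply, smul_eq_mul, abs_mul, abs_inv, mul_comm]
    have ha : |W.adjugate j l| ≤ k.factorial := by
      rw [Matrix.adjugate_apply]
      apply hdetle
      intro a b
      by_cases h : a = l
      · subst h
        by_cases h' : b = j
        · subst h'; simp
        · simp [h']
      · simp [h, hWe]
    have hb : |W.det|⁻¹ ≤ (d:ℝ) ^ k / ν := by
      rw [← inv_div]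
      exact inv_anti₀ (by positivity) hWlow
    gcongr
  · have e : (W⁻¹ * U) * (W⁻¹ * U).transpose = W⁻¹ * (U * U.transpose) * (W⁻¹).transpose := by
      simp [Matrix.transpose_mul, Matrix.mul_assoc]
    rw [e, Matrix.det_mul, Matrix.det_mul, Matrix.det_transpose, Matrix.det_nonsing_inv, Ring.inverse_eq_inv']
    have h2 := hdetle W hWe
    have h3 : W.det ^ 2 ≤ (k.factorial:ℝ) ^ 2 := by
      rw [← sq_abs]; gcongr
    have h4 : 0 < W.det ^ 2 := by positivity
    calc ν / (k.factorial:ℝ)^2 ≤ ν / W.det ^ 2 := by gcongr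
      _ ≤ (U * U.transpose).det / W.det ^ 2 := by gcongr
      _ = _ := by field_simp

theorem aux_pigeon {k : ℕ} {α : Type*} [DecidableEq α] (S : Finset α) (hS : S.Nonempty) (y : α → Fin k → ℝ)
    (a : Fin k → ℝ) (h : ∀ n ∈ S, ∀ l, |y n l - a l| ≤ 1) (Q : ℕ) (hQ : 0 < Q) :
    ∃ T ⊆ S, T.Nonempty ∧ S.card ≤ (2 * Q + 1) ^ k * T.card ∧
      ∀ n ∈ T, ∀ m ∈ T, ∀ l, |y n l - y m l| ≤ 1 / Q := by
  classical
  let f : α → Fin k → ℤ := fun n l => ⌊(y n l - a l) * Q⌋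
  let t : Finset (Fin k → ℤ) := Fintype.piFinset fun _ => Finset.Icc (-(Q:ℤ)) Q
  have hQ' : (0:ℝ) < Q := by exact_mod_cast hQ
  have hf : ∀ n ∈ S, f n ∈ t := by
    intro n hn
    simp only [t, Fintype.mem_piFinset, Finset.mem_Icc, f]
    intro l
    have := abs_le.mp (h n hn l)
    constructor
    · rw [Int.le_floor]; push_cast; nlinarith
    · have : (⌊(y n l - a l) * Q⌋ : ℝ) ≤ Q := (Int.floor_le _).trans (by nlinarith)
      exact_mod_cast this
  have htc : t.card = (2 * Q + 1) ^ k := by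
    simp only [t, Fintype.card_piFinset, Int.card_Icc, Finset.prod_const, Finset.card_univ, Fintype.card_fin]
    congr 1; omega
  have : ∃ y ∈ t, S.card ≤ t.card * (S.filter (fun x => f x = y)).card := by
    by_contra! hc
    have e := Finset.card_eq_sum_card_fiberwise (s := S) (t := t) (f := f) hf
    have ht : t.Nonempty := ⟨_, hf _ hS.choose_spec⟩
    have : ∑ b ∈ t, t.card * (S.filter (fun x => f x = b)).card < ∑ b ∈ t, S.card :=
      Finset.sum_lt_sum_of_nonempty ht hc
    rw [← Finset.mul_sum, Finset.sum_const, smul_eq_mul, ← e] at this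
    omega
  obtain ⟨b, -, hb⟩ := this
  refine ⟨S.filter (fun x => f x = b), Finset.filter_subset _ _, ?_, htc ▸ hb, ?_⟩
  · rw [Finset.nonempty_iff_ne_empty]
    intro h0
    rw [h0] at hb
    simp at hb
    exact hS.ne_empty hb
  · intro n hn m hm l
    have h1 : f n l = f m l := by rw [(Finset.mem_filter.mp hn).2, (Finset.mem_filter.mp hm).2]
    have h2 := Int.abs_sub_lt_one_of_floor_eq_floor h1
    rw [show (y n l - a l) * (Q:ℝ) - (y m l - a l) * Q = (y n l - y m l) * Q by ring, abs_mul,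
      abs_of_pos hQ'] at h2
    rw [le_div_iff₀ hQ']
    exact h2.le

theorem aux_int_s5 {k : ℕ} {α : Type*} [DecidableEq α] (E T : Finset α) (hTE : T ⊆ E) (hT : T.Nonempty)
    (φ : α → (Fin k → ℝ) → ℝ) (hφc : ∀ n, Continuous (φ n))
    (hφ : ∀ n ∈ T, ∀ m ∈ T, ∀ t ∈ Set.univ.pi (fun _ : Fin k => Set.Icc (-1 : ℝ) 1), |φ n t - φ m t| ≤ 1) :
    ∃ co : α → ℂ, (∑ n ∈ E, ‖co n‖ ^ 2) = 1 ∧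
      2 ^ k * (T.card / 4 : ℝ) ≤ (∫ t in Set.univ.pi (fun _ : Fin k => Set.Icc (-1 : ℝ) 1),
                    ‖∑ n ∈ E, co n * Complex.exp (Complex.I * (φ n t : ℂ))‖ ^ 2) ∧
      (∫ t in Set.univ.pi (fun _ : Fin k => Set.Icc (-1 : ℝ) 1),
                    ‖∑ n ∈ E, co n * Complex.exp (Complex.I * (φ n t : ℂ))‖ ^ 2) ≤ 2 ^ k * (T.card : ℝ) := by
  classical
  set N : ℝ := (T.card : ℝ) with hN
  have hNpos : 0 < N := by rw [hN]; exact_mod_cast hT.card_pos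
  set r : ℝ := (Real.sqrt N)⁻¹ with hr
  have hrpos : 0 < r := by positivity
  have hr2 : r ^ 2 = N⁻¹ := by rw [hr, inv_pow, Real.sq_sqrt hNpos.le]
  set B := Set.univ.pi (fun _ : Fin k => Set.Icc (-1 : ℝ) 1) with hB
  have hBc : IsCompact B := isCompact_univ_pi fun _ => isCompact_Icc
  have hBv : volume.real B = 2 ^ k := by
    rw [hB, Measure.real, volume_pi_pi]
    simp
    norm_num
  have hBm : MeasurableSet B := hBc.measurableSet
  have hconst : ∀ c : ℝ, ∫ t in B, c = 2 ^ k * c := by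
    intro c; rw [setIntegral_const, hBv, smul_eq_mul]
  let co : α → ℂ := fun n => if n ∈ T then (r : ℂ) else 0
  have hsum : ∀ t, ∑ n ∈ E, co n * Complex.exp (Complex.I * (φ n t : ℂ)) =
      r * ∑ n ∈ T, Complex.exp (Complex.I * (φ n t : ℂ)) := by
    intro t
    rw [Finset.mul_sum, ← Finset.sum_subset hTE]
    · exact Finset.sum_congr rfl fun n hn => by simp [co, hn]
    · intro n _ hn; simp [co, hn]
  have hnorm : ∀ t, ‖∑ n ∈ E, co n * Complex.exp (Complex.I * (φ n t : ℂ))‖ ^ 2 =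
      N⁻¹ * ‖∑ n ∈ T, Complex.exp (Complex.I * (φ n t : ℂ))‖ ^ 2 := by
    intro t
    rw [hsum, norm_mul, mul_pow, Complex.norm_real, Real.norm_eq_abs, sq_abs, hr2]
  have hcont : Continuous fun t => N⁻¹ * ‖∑ n ∈ T, Complex.exp (Complex.I * (φ n t : ℂ))‖ ^ 2 := by
    fun_prop
  have hint : IntegrableOn (fun t => N⁻¹ * ‖∑ n ∈ T, Complex.exp (Complex.I * (φ n t : ℂ))‖ ^ 2) B :=
    hcont.continuousOn.integrableOn_compact hBc
  have hintc : ∀ c : ℝ, IntegrableOn (fun _ : Fin k → ℝ => c) B := fun c =>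
    continuous_const.continuousOn.integrableOn_compact hBc
  refine ⟨co, ?_, ?_, ?_⟩
  · rw [← Finset.sum_subset hTE]
    · rw [Finset.sum_congr rfl (g := fun _ => N⁻¹)]
      · rw [Finset.sum_const, nsmul_eq_mul, ← hN]; field_simp
      · intro n hn; simp [co, hn, hr2]
    · intro n _ hn; simp [co, hn]
  · simp_rw [hnorm]
    rw [← hconst]
    refine setIntegral_mono_on (hintc _) hint hBm ?_
    intro t ht
    obtain ⟨m, hm⟩ := hT
    have h1 : ‖∑ n ∈ T, Complex.exp (Complex.I * (φ n t : ℂ))‖ =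
        ‖∑ n ∈ T, Complex.exp (((φ n t - φ m t : ℝ) : ℂ) * Complex.I)‖ := by
      have : ∑ n ∈ T, Complex.exp (((φ n t - φ m t : ℝ) : ℂ) * Complex.I) =
          Complex.exp (((- φ m t : ℝ) : ℂ) * Complex.I) * ∑ n ∈ T, Complex.exp (Complex.I * (φ n t : ℂ)) := by
        rw [Finset.mul_sum]
        refine Finset.sum_congr rfl fun n _ => ?_
        rw [← Complex.exp_add]; congr 1; push_cast; ring
      rw [this, norm_mul, Complex.norm_exp_ofReal_mul_I, one_mul]
    have h2 : N / 2 ≤ ‖∑ n ∈ T, Complex.exp (Complex.I * (φ n t : ℂ))‖ := by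
      rw [h1]
      refine le_trans ?_ (Complex.re_le_norm _)
      rw [Complex.re_sum]
      have : ∑ n ∈ T, (1/2 : ℝ) ≤ ∑ n ∈ T, (Complex.exp (((φ n t - φ m t : ℝ) : ℂ) * Complex.I)).re := by
        refine Finset.sum_le_sum fun n hn => ?_
        rw [Complex.exp_ofReal_mul_I_re]
        have h3 := hφ n hn m hm t ht
        have h4 : (φ n t - φ m t)^2 ≤ 1 := by
          rw [← sq_abs]; exact pow_le_one₀ (abs_nonneg _) h3
        have := Real.one_sub_sq_div_two_le_cos (x := φ n t - φ m t)
        linarith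
      refine le_trans (le_of_eq ?_) this
      rw [Finset.sum_const, nsmul_eq_mul, ← hN]; ring
    calc N / 4 = N⁻¹ * (N/2)^2 := by field_simp; norm_num
      _ ≤ _ := by gcongr
  · simp_rw [hnorm]
    rw [← hconst]
    refine setIntegral_mono_on hint (hintc _) hBm ?_
    intro t ht
    have h2 : ‖∑ n ∈ T, Complex.exp (Complex.I * (φ n t : ℂ))‖ ≤ N := by
      refine (norm_sum_le _ _).trans (le_of_eq ?_)
      rw [Finset.sum_congr rfl (g := fun _ => (1:ℝ))]
      · simp [hN]
      · intro n _; rw [mul_comm]; exact Complex.norm_exp_ofReal_mul_I _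
    calc _ ≤ N⁻¹ * N^2 := by gcongr
      _ = N := by field_simp

theorem aux_A (d k : ℕ) (hk : k ≤ d) (lam : ℝ) (E : Finset (Fin d → ℤ))
    (hE : ∀ n : Fin d → ℤ, n ∈ E ↔ (∑ i, ((n i : ℝ)) ^ 2) = lam ^ 2) (hne : E.Nonempty) :
    1 ≤ Akd k d lam ∧ ∃ (u x₀ : Fin k → Fin d → ℝ),
    (∀ j, u j ≠ 0) ∧
    (((d : ℝ) - k + 1) ^ (-(k : ℝ) / 2)) * ∏ j, Real.sqrt (∑ l, (u j l) ^ 2) ≤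
      Real.sqrt (Matrix.det (Matrix.of fun i j : Fin k => ∑ l, u i l * u j l)) ∧
    Akd k d lam = Set.ncard {n : Fin d → ℤ |
      (∑ i, ((n i : ℝ)) ^ 2) = lam ^ 2 ∧
      ∀ j, |∑ i, u j i * ((n i : ℝ) - x₀ j i)| ≤ Real.sqrt (∑ i, (u j i) ^ 2)} := by
  have hsub : ∀ u x₀ : Fin k → Fin d → ℝ, {n : Fin d → ℤ |
      (∑ i, ((n i : ℝ)) ^ 2) = lam ^ 2 ∧
      ∀ j, |∑ i, u j i * ((n i : ℝ) - x₀ j i)| ≤ Real.sqrt (∑ i, (u j i) ^ 2)} ⊆ (E : Set (Fin d → ℤ)) := by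
    intro u x₀ n hn
    exact Finset.mem_coe.mpr ((hE n).mpr hn.1)
  obtain ⟨n₀, hn₀⟩ := hne
  set Z := {N : ℕ | ∃ (u x₀ : Fin k → Fin d → ℝ),
    (∀ j, u j ≠ 0) ∧
    (((d : ℝ) - k + 1) ^ (-(k : ℝ) / 2)) * ∏ j, Real.sqrt (∑ l, (u j l) ^ 2) ≤
      Real.sqrt (Matrix.det (Matrix.of fun i j : Fin k => ∑ l, u i l * u j l)) ∧
    N = Set.ncard {n : Fin d → ℤ |
      (∑ i, ((n i : ℝ)) ^ 2) = lam ^ 2 ∧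
      ∀ j, |∑ i, u j i * ((n i : ℝ) - x₀ j i)| ≤ Real.sqrt (∑ i, (u j i) ^ 2)}} with hZ
  have hA : Akd k d lam = sSup Z := rfl
  have hbdd : BddAbove Z := by
    refine ⟨E.card, ?_⟩
    rintro N ⟨u, x₀, -, -, rfl⟩
    rw [← Set.ncard_coe_finset]
    exact Set.ncard_le_ncard (hsub u x₀) E.finite_toSet
  let u : Fin k → Fin d → ℝ := fun j i => if i = Fin.castLE hk j then 1 else 0
  let x₀ : Fin k → Fin d → ℝ := fun _ i => n₀ i
  have hu1 : ∀ j, ∑ l, (u j l) ^ 2 = 1 := by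
    intro j; simp [u]
  have hu2 : (Matrix.of fun i j : Fin k => ∑ l, u i l * u j l) = 1 := by
    ext i j
    simp [u, Matrix.one_apply, eq_comm]
  have hmem : Set.ncard {n : Fin d → ℤ |
      (∑ i, ((n i : ℝ)) ^ 2) = lam ^ 2 ∧
      ∀ j, |∑ i, u j i * ((n i : ℝ) - x₀ j i)| ≤ Real.sqrt (∑ i, (u j i) ^ 2)} ∈ Z := by
    refine ⟨u, x₀, ?_, ?_, rfl⟩
    · intro j hj
      have := congrFun hj (Fin.castLE hk j)
      simp [u] at this
    · rw [hu2]
      simp only [hu1]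
      simp
      have hkd : (k:ℝ) ≤ d := by exact_mod_cast hk
      apply Real.rpow_le_one_of_one_le_of_nonpos
      · linarith
      · have : (0:ℝ) ≤ k := by positivity
        linarith
  have h1 : 1 ≤ Set.ncard {n : Fin d → ℤ |
      (∑ i, ((n i : ℝ)) ^ 2) = lam ^ 2 ∧
      ∀ j, |∑ i, u j i * ((n i : ℝ) - x₀ j i)| ≤ Real.sqrt (∑ i, (u j i) ^ 2)} := by
    rw [Nat.one_le_iff_ne_zero, ← Nat.pos_iff_ne_zero, Set.ncard_pos (E.finite_toSet.subset (hsub u x₀))]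
    refine ⟨n₀, (hE n₀).mp hn₀, ?_⟩
    intro j
    simp [x₀]
  refine ⟨?_, ?_⟩
  · rw [hA]; exact h1.trans (le_csSup hbdd hmem)
  · rw [hA]; exact Nat.sSup_mem ⟨_, hmem⟩ hbdd

theorem stmt5 (d k : ℕ) (hd : 3 ≤ d) (hk1 : 1 ≤ k) (hk2 : k ≤ d - 1) :
    ∃ c C : ℝ, 0 < c ∧ 0 < C ∧
      ∀ (lam : ℝ), 1 ≤ lam →
        ∀ (E : Finset (Fin d → ℤ)),
          (∀ n : Fin d → ℤ, n ∈ E ↔ (∑ i, ((n i : ℝ)) ^ 2) = lam ^ 2) →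
          E.Nonempty →
            ∃ (u : Fin k → Fin d → ℝ) (co : (Fin d → ℤ) → ℂ),
              (∀ (j : Fin k) (i : Fin d),
                (i.val < k → u j i = if i.val = j.val then 1 else 0) ∧
                (k ≤ i.val → |u j i| ≤ 1)) ∧
              (∑ n ∈ E, ‖co n‖ ^ 2) = 1 ∧
              c * (Akd k d lam) ≤
                Real.sqrt (Matrix.det (Matrix.of fun i j : Fin k => ∑ l, u i l * u j l)) *
                  (∫ t in Set.univ.pi (fun _ : Fin k => Set.Icc (-1 : ℝ) 1),
                    ‖∑ n ∈ E, co n *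
                      Complex.exp (Complex.I * (dotIR n (fun i => ∑ j, t j * u j i) : ℂ))‖ ^ 2) ∧
              Real.sqrt (Matrix.det (Matrix.of fun i j : Fin k => ∑ l, u i l * u j l)) *
                  (∫ t in Set.univ.pi (fun _ : Fin k => Set.Icc (-1 : ℝ) 1),
                    ‖∑ n ∈ E, co n *
                      Complex.exp (Complex.I * (dotIR n (fun i => ∑ j, t j * u j i) : ℂ))‖ ^ 2)
                ≤ C * (Akd k d lam) := by
  classical
  have hkd : k ≤ d := by omega
  have hkdR : (k:ℝ) ≤ d := by exact_mod_cast hkd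
  have hd0 : 0 < d := by omega
  set ν : ℝ := ((d : ℝ) - k + 1) ^ (-(k : ℝ) / 2) with hν
  have hνpos : 0 < ν := Real.rpow_pos_of_pos (by linarith) _
  set B : ℝ := (k.factorial : ℝ) * ((d : ℝ) ^ k / ν ^ 2) with hB
  have hBpos : 0 < B := by
    have : (0:ℝ) < d := by exact_mod_cast hd0
    positivity
  obtain ⟨Q, hQ⟩ := exists_nat_gt ((k:ℝ) * (k * B))
  have hQpos : 0 < Q := by
    have : (0:ℝ) < Q := lt_of_le_of_lt (by positivity) hQ
    exact_mod_cast this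
  have hQR : (0:ℝ) < Q := by exact_mod_cast hQpos
  set N : ℝ := (2 * (Q:ℝ) + 1) ^ k with hN
  have hNpos : 0 < N := by positivity
  have hfac : (0:ℝ) < k.factorial := by exact_mod_cast k.factorial_pos
  have hdR : (0:ℝ) < d := by exact_mod_cast hd0
  refine ⟨Real.sqrt (ν ^ 2 / (k.factorial : ℝ) ^ 2) * (2 ^ k / 4 / N),
    Real.sqrt (k.factorial * (d:ℝ) ^ k) * 2 ^ k, by positivity, by positivity, ?_⟩
  intro lam _ E hE hne
  obtain ⟨hA1, u, x₀, hu0, hutr, hA⟩ := aux_A d k hkd lam E hE hne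
  have hrpos : ∀ j, 0 < Real.sqrt (∑ l, (u j l) ^ 2) := by
    intro j
    apply Real.sqrt_pos.mpr
    obtain ⟨i, hi⟩ := Function.ne_iff.mp (hu0 j)
    have hi : u j i ≠ 0 := hi
    exact Finset.sum_pos' (fun _ _ => sq_nonneg _) ⟨i, Finset.mem_univ _, by positivity⟩
  set r : Fin k → ℝ := fun j => Real.sqrt (∑ l, (u j l) ^ 2) with hr
  have hrpos : ∀ j, 0 < r j := hrpos
  let U : Matrix (Fin k) (Fin d) ℝ := Matrix.of fun j l => (r j)⁻¹ * u j l
  have hU : ∀ i j, |U i j| ≤ 1 := by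
    intro i j
    show |(r i)⁻¹ * u i j| ≤ 1
    rw [abs_mul, abs_inv, abs_of_pos (hrpos i), inv_mul_le_iff₀ (hrpos i), mul_one]
    apply Real.abs_le_sqrt
    exact Finset.single_le_sum (f := fun l => u i l ^ 2) (fun _ _ => sq_nonneg _) (Finset.mem_univ j)
  have hUdet : ν ^ 2 ≤ (U * U.transpose).det := by
    set G := Matrix.of fun i j : Fin k => ∑ l, u i l * u j l with hG
    have e : U * U.transpose = Matrix.diagonal (fun j => (r j)⁻¹) * G * Matrix.diagonal (fun j => (r j)⁻¹) := by
      ext i j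
      rw [Matrix.mul_diagonal, Matrix.diagonal_mul]
      simp only [Matrix.mul_apply, Matrix.transpose_apply, U, hG,
        Matrix.of_apply, Finset.mul_sum, Finset.sum_mul]
      exact Finset.sum_congr rfl fun l _ => by ring
    rw [e, Matrix.det_mul, Matrix.det_mul, Matrix.det_diagonal, Finset.prod_inv_distrib]
    have hP : 0 < ∏ j, r j := Finset.prod_pos fun j _ => hrpos j
    have hlt : 0 < ν * ∏ j, r j := by positivity
    have hGpos : 0 < G.det := Real.sqrt_pos.mp (lt_of_lt_of_le hlt hutr)
    have h2 : (ν * ∏ j, r j) ^ 2 ≤ G.det := by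
      rw [← Real.sq_sqrt hGpos.le]; exact pow_le_pow_left₀ hlt.le hutr 2
    rw [mul_pow] at h2
    have : (∏ j, r j)⁻¹ * G.det * (∏ j, r j)⁻¹ = G.det / (∏ j, r j) ^ 2 := by
      field_simp
    rw [this, le_div_iff₀ (by positivity)]
    exact h2
  obtain ⟨M, p, hpinj, hMp, hM1, hMB, hMdet⟩ := aux_alg hd0 (ν ^ 2) (by positivity) U hU hUdet
  obtain ⟨σ, hσ⟩ := Equiv.Perm.exists_extending_pair (Fin.castLE hkd) p (Fin.castLE_injective hkd) hpinj
  set V := M * U with hV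
  -- the lattice points
  set S : Finset (Fin d → ℤ) := E.filter fun n =>
    ∀ j, |∑ i, u j i * ((n i : ℝ) - x₀ j i)| ≤ r j with hS
  have hScard : Akd k d lam = S.card := by
    rw [hA, ← Set.ncard_coe_finset]
    congr 1
    ext n
    simp [hS, hE, hr]
  have hSne : S.Nonempty := by
    rw [← Finset.card_pos, ← hScard]; omega
  let y : (Fin d → ℤ) → Fin k → ℝ := fun n l => ∑ i, U l i * n i
  let a : Fin k → ℝ := fun l => ∑ i, U l i * x₀ l i
  have hya : ∀ n ∈ S, ∀ l, |y n l - a l| ≤ 1 := by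
    intro n hn l
    have h := (Finset.mem_filter.mp hn).2 l
    have e : y n l - a l = (r l)⁻¹ * ∑ i, u l i * ((n i : ℝ) - x₀ l i) := by
      simp only [y, a, U, Matrix.of_apply]
      rw [← Finset.sum_sub_distrib, Finset.mul_sum]
      exact Finset.sum_congr rfl fun i _ => by ring
    rw [e, abs_mul, abs_inv, abs_of_pos (hrpos l), inv_mul_le_iff₀ (hrpos l), mul_one]
    exact h
  obtain ⟨T, hTS, hTne, hTcard, hT⟩ := aux_pigeon S hSne y a hya Q hQpos
  let pm : (Fin d → ℤ) → (Fin d → ℤ) := fun n i => n (σ i)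
  have hpm : Function.Injective pm := by
    intro n m h
    funext i
    have := congrFun h (σ.symm i)
    simpa [pm] using this
  let v : Fin k → Fin d → ℝ := fun j i => V j (σ i)
  let φ : (Fin d → ℤ) → (Fin k → ℝ) → ℝ := fun n t => dotIR n (fun i => ∑ j, t j * v j i)
  have hφe : ∀ m t, φ (pm m) t = ∑ j, t j * ∑ l, M j l * y m l := by
    intro m t
    have e1 : φ (pm m) t = ∑ i, (m i : ℝ) * ∑ j, t j * V j i := by
      simp only [φ, dotIR, pm, v]
      exact Equiv.sum_comp σ (fun i => (m i : ℝ) * ∑ j, t j * V j i)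
    rw [e1]
    simp only [hV, Matrix.mul_apply, y, Finset.mul_sum]
    rw [Finset.sum_comm]
    refine Finset.sum_congr rfl fun j _ => ?_
    rw [Finset.sum_comm]
    refine Finset.sum_congr rfl fun l _ => Finset.sum_congr rfl fun i _ => ?_
    ring
  have hφc : ∀ n, Continuous (φ n) := by
    intro n
    simp only [φ, dotIR]
    fun_prop
  have hT'E : T.image pm ⊆ E := by
    intro n hn
    obtain ⟨m, hm, rfl⟩ := Finset.mem_image.mp hn
    have := (hE m).mp (Finset.mem_filter.mp (hTS hm)).1
    rw [hE, ← this]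
    exact Equiv.sum_comp σ (fun i => ((m i : ℝ)) ^ 2)
  obtain ⟨co, hco1, hco2, hco3⟩ := aux_int_s5 E (T.image pm) hT'E (hTne.image _) φ hφc (by
    intro n' hn' m' hm' t ht
    obtain ⟨n, hn, rfl⟩ := Finset.mem_image.mp hn'
    obtain ⟨m, hm, rfl⟩ := Finset.mem_image.mp hm'
    rw [hφe, hφe, ← Finset.sum_sub_distrib]
    have : ∀ j ∈ (Finset.univ : Finset (Fin k)),
        |t j * ∑ l, M j l * y n l - t j * ∑ l, M j l * y m l| ≤ k * (B * (1 / Q)) := by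
      intro j _
      rw [← mul_sub, ← Finset.sum_sub_distrib, abs_mul]
      have h1 : |t j| ≤ 1 := abs_le.mpr (ht j (Set.mem_univ _))
      have h2 : |∑ l, (M j l * y n l - M j l * y m l)| ≤ k * (B * (1 / Q)) := by
        refine (Finset.abs_sum_le_sum_abs _ _).trans ?_
        have h3 : ∀ l ∈ (Finset.univ : Finset (Fin k)),
            |M j l * y n l - M j l * y m l| ≤ B * (1 / Q) := by
          intro l _
          rw [← mul_sub, abs_mul]
          exact mul_le_mul (hMB j l) (hT n hn m hm l) (abs_nonneg _) hBpos.le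
        refine (Finset.sum_le_sum h3).trans ?_
        simp
      calc _ ≤ 1 * (k * (B * (1 / Q))) := mul_le_mul h1 h2 (abs_nonneg _) zero_le_one
        _ = _ := one_mul _
    refine (Finset.abs_sum_le_sum_abs _ _).trans ((Finset.sum_le_sum this).trans ?_)
    rw [Finset.sum_const, nsmul_eq_mul, Finset.card_univ, Fintype.card_fin,
      show (k:ℝ) * (k * (B * (1 / Q))) = (k * (k * B)) / Q by ring, div_le_one hQR]
    exact hQ.le)
  rw [Finset.card_image_of_injective _ hpm] at hco2 hco3
  have hgram : (Matrix.of fun i j : Fin k => ∑ l, v i l * v j l) = V * V.transpose := by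
    ext i j
    simp only [Matrix.of_apply, Matrix.mul_apply, Matrix.transpose_apply, v]
    exact Equiv.sum_comp σ (fun l => V i l * V j l)
  have hdetup : (V * V.transpose).det ≤ k.factorial * (d:ℝ) ^ k := by
    have h := Matrix.det_le (abv := AbsoluteValue.abs) (A := V * V.transpose) (x := (d:ℝ)) (by
      intro i j
      rw [AbsoluteValue.abs_apply, Matrix.mul_apply]
      refine (Finset.abs_sum_le_sum_abs _ _).trans ?_
      have h3 : ∀ l ∈ (Finset.univ : Finset (Fin d)), |V i l * V.transpose l j| ≤ 1 := by
        intro l _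
        rw [abs_mul]
        exact mul_le_one₀ (hM1 i l) (abs_nonneg _) (hM1 j l)
      refine (Finset.sum_le_sum h3).trans ?_
      simp)
    refine (le_abs_self _).trans ?_
    simpa using h
  have hTS' : (T.card : ℝ) ≤ Akd k d lam := by
    rw [hScard]; exact_mod_cast Finset.card_le_card hTS
  have hST : (Akd k d lam : ℝ) ≤ N * T.card := by
    rw [hScard, hN]; exact_mod_cast hTcard
  refine ⟨v, co, ?_, hco1, ?_, ?_⟩
  · intro j i
    refine ⟨fun hi => ?_, fun _ => hM1 _ _⟩
    have e : i = Fin.castLE hkd ⟨i.val, hi⟩ := rfl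
    have e2 : σ i = p ⟨i.val, hi⟩ := by
      rw [← hσ]; rfl
    show V j (σ i) = _
    rw [e2, hMp]
    simp [Fin.ext_iff]
  · rw [hgram]
    have h5 : (2:ℝ) ^ k / 4 / N * (Akd k d lam) ≤ 2 ^ k * (T.card / 4 : ℝ) := by
      calc (2:ℝ) ^ k / 4 / N * (Akd k d lam) ≤ (2:ℝ) ^ k / 4 / N * (N * T.card) := by gcongr
        _ = _ := by field_simp
    rw [mul_assoc]
    exact mul_le_mul (Real.sqrt_le_sqrt hMdet) (h5.trans hco2) (by positivity) (Real.sqrt_nonneg _)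
  · rw [hgram, mul_assoc]
    have h6 : (2:ℝ) ^ k * (T.card : ℝ) ≤ 2 ^ k * (Akd k d lam) := by gcongr
    exact mul_le_mul (Real.sqrt_le_sqrt hdetup) (hco3.trans h6)
      (integral_nonneg fun _ => by positivity) (Real.sqrt_nonneg _)
end

section
/- For every ε > 0 there exists a constant C = C(ε) such that for every λ ≥ 1, every x₀ ∈ ℝ³, every unit vector v ∈ ℝ³, and every choice of complex coefficients (c_n)_{n∈E} with E = {n ∈ ℤ³ : |n| = λ}, one has ∫₀¹ |Σ_{n∈E} c_n e^{i n·(x₀+tv)}|² dt ≤ C · λ^{2/3+ε} · Σ_{n∈E} |c_n|². Equivalently, every eigenfunction e_λ on T³ satisfies ‖e_λ‖_{L²(γ)} ≲ λ^{1/3+ε} ‖e_λ‖_{L²(T³)} for every unit-length geodesic segment γ, with constant independent of γ and λ. -/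
open MeasureTheory

theorem divisor_bound (δ : ℝ) (hδ : 0 < δ) :
    ∃ C : ℝ, 1 ≤ C ∧ ∀ n : ℕ, n ≠ 0 → (n.divisors.card : ℝ) ≤ C * (n : ℝ) ^ δ := by
  obtain ⟨T, hT⟩ := exists_nat_gt ((2:ℝ) ^ (1 / δ))
  set A : ℝ := 1 + 1 / (δ * Real.log 2) with hA
  have hl2 : 0 < Real.log 2 := Real.log_pos (by norm_num)
  have hA1 : 1 ≤ A := by
    have : 0 ≤ 1 / (δ * Real.log 2) := by positivity
    linarith
  refine ⟨A ^ T, one_le_pow₀ hA1, fun n hn => ?_⟩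
  rw [Nat.card_divisors hn]
  push_cast
  have hfac : (n : ℝ) ^ δ = ∏ p ∈ n.primeFactors, ((p : ℝ) ^ δ) ^ (n.factorization p) := by
    conv_lhs => rw [← Nat.prod_factorization_pow_eq_self hn]
    rw [Finsupp.prod, Nat.support_factorization]
    push_cast
    rw [← Real.finsetProd_rpow _ _ (fun i _ => by positivity)]
    refine Finset.prod_congr rfl fun p _ => ?_
    rw [← Real.rpow_natCast, ← Real.rpow_natCast, ← Real.rpow_mul (by positivity), ← Real.rpow_mul (by positivity), mul_comm]
  have hpt : ∀ p ∈ n.primeFactors, ((n.factorization p : ℝ) + 1) ≤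
      (if p < T then A else 1) * ((p : ℝ) ^ δ) ^ (n.factorization p) := by
    intro p hp
    have hp2 : (2:ℝ) ≤ p := by exact_mod_cast (Nat.prime_of_mem_primeFactors hp).two_le
    set e := n.factorization p
    split_ifs with h
    · have h1 : (2:ℝ) ^ δ ≤ (p : ℝ) ^ δ := Real.rpow_le_rpow (by norm_num) hp2 hδ.le
      have h2 : (1:ℝ) + e * (δ * Real.log 2) ≤ ((p : ℝ) ^ δ) ^ e := by
        calc (1:ℝ) + e * (δ * Real.log 2) ≤ Real.exp (e * (δ * Real.log 2)) := by
              rw [add_comm]; exact Real.add_one_le_exp _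
          _ = ((2:ℝ) ^ δ) ^ e := by
              rw [Real.rpow_def_of_pos (by norm_num), ← Real.exp_nat_mul]; ring_nf
          _ ≤ _ := pow_le_pow_left₀ (by positivity) h1 _
      have h3 : (e:ℝ) + 1 ≤ A * (1 + e * (δ * Real.log 2)) := by
        rw [hA]
        have : (1 + 1 / (δ * Real.log 2)) * (1 + e * (δ * Real.log 2)) = e + 1 + 1 / (δ * Real.log 2) + e * (δ * Real.log 2) := by
          field_simp; ring
        rw [this]
        have : 0 ≤ 1 / (δ * Real.log 2) := by positivity
        have : 0 ≤ e * (δ * Real.log 2) := by positivity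
        linarith
      exact h3.trans (mul_le_mul_of_nonneg_left h2 (by linarith))
    · have hpT : (2:ℝ) ^ (1 / δ) ≤ p := by
        have : (T:ℝ) ≤ p := by exact_mod_cast not_lt.mp h
        linarith
      have h1 : (2:ℝ) ≤ (p : ℝ) ^ δ := by
        have := Real.rpow_le_rpow (by positivity) hpT hδ.le
        rwa [← Real.rpow_mul (by norm_num), one_div_mul_cancel hδ.ne', Real.rpow_one] at this
      rw [one_mul]
      calc (e:ℝ) + 1 ≤ (2:ℝ) ^ e := by
            have := Nat.lt_two_pow_self (n := e)
            exact_mod_cast this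
        _ ≤ _ := pow_le_pow_left₀ (by positivity) h1 _
  calc _ ≤ ∏ p ∈ n.primeFactors, ((if p < T then A else 1) * ((p : ℝ) ^ δ) ^ (n.factorization p)) :=
        Finset.prod_le_prod (fun _ _ => by positivity) hpt
    _ = (∏ p ∈ n.primeFactors, (if p < T then A else 1)) * (n : ℝ) ^ δ := by
        rw [Finset.prod_mul_distrib, hfac]
    _ ≤ A ^ T * (n : ℝ) ^ δ := by
        refine mul_le_mul_of_nonneg_right ?_ (by positivity)
        rw [Finset.prod_ite, Finset.prod_const, Finset.prod_const, one_pow, mul_one]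
        refine pow_le_pow_right₀ hA1 ?_
        calc _ ≤ (Finset.range T).card := Finset.card_le_card (by
              intro x hx; simp at hx ⊢; exact hx.2)
          _ = T := Finset.card_range T
theorem quad_base (M : ℕ) (hM : M ≠ 0) (a b : ℤ) (ha : 0 < a) (hb : 0 < b)
    (hab : ∀ p : ℤ, Prime p → p ∣ M → ¬ p ∣ a * b) (S : Finset (ℤ × ℤ))
    (hS : ∀ p ∈ S, a * p.1 ^ 2 + b * p.2 ^ 2 = M ∧ IsCoprime p.1 p.2) :
    S.card ≤ 10 * M.divisors.card := by
  have hMpos : (0:ℤ) < M := by exact_mod_cast Nat.pos_of_ne_zero hM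
  have hM0 : (M:ℤ) ≠ 0 := hMpos.ne'
  rcases S.eq_empty_or_nonempty with rfl | ⟨⟨x, y⟩, hxy⟩
  · simp
  obtain ⟨hxyM, hcop⟩ := hS _ hxy
  simp only at hxyM hcop
  -- solutions are coprime to M
  have key : ∀ p ∈ S, IsCoprime (M:ℤ) p.1 ∧ IsCoprime (M:ℤ) p.2 := by
    intro p hp
    obtain ⟨h1, h2⟩ := hS p hp
    constructor
    · refine isCoprime_of_prime_dvd (fun h => hM0 h.1) fun z hz hzM hzx => ?_
      have : z ∣ b * p.2 ^ 2 := by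
        have : b * p.2 ^ 2 = M - a * p.1 * p.1 := by rw [← h1]; ring
        rw [this]; exact dvd_sub hzM (hzx.mul_left _)
      rcases hz.dvd_or_dvd this with h | h
      · exact hab z hz hzM (h.mul_left _)
      · exact hz.not_isUnit (h2.isUnit_of_dvd' hzx (hz.dvd_of_dvd_pow h))
    · refine isCoprime_of_prime_dvd (fun h => hM0 h.1) fun z hz hzM hzx => ?_
      have : z ∣ a * p.1 ^ 2 := by
        have : a * p.1 ^ 2 = M - b * p.2 * p.2 := by rw [← h1]; ring
        rw [this]; exact dvd_sub hzM (hzx.mul_left _)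
      rcases hz.dvd_or_dvd this with h | h
      · exact hab z hz hzM (h.mul_right _)
      · exact hz.not_isUnit (h2.isUnit_of_dvd' (hz.dvd_of_dvd_pow h) hzx)
  have hacop : IsCoprime (M:ℤ) a := 
    isCoprime_of_prime_dvd (fun h => hM0 h.1) fun z hz hzM hza => hab z hz hzM (hza.mul_right _)
  have hG : ∀ p : ℤ × ℤ, ∃ g : ℕ, p ∈ S → g ∈ M.divisors ∧ (g:ℤ) ∣ x * p.2 - p.1 * y ∧
      ∃ h : ℤ, (M:ℤ) = g * h ∧ h ∣ x * p.2 + p.1 * y := by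
    rintro ⟨u, v⟩
    by_cases hp : (u, v) ∈ S
    · obtain ⟨h1, h2⟩ := hS _ hp
      simp only at h1 h2
      have : (M:ℤ) ∣ (x * v - u * y) * (x * v + u * y) := by
        refine hacop.dvd_of_dvd_mul_left ⟨v ^ 2 - y ^ 2, ?_⟩
        linear_combination v ^ 2 * hxyM - y ^ 2 * h1
      obtain ⟨d1, d2, hd1, hd2, hd⟩ := exists_dvd_and_dvd_of_dvd_mul this
      refine ⟨d1.natAbs, fun _ => ⟨?_, ?_, ?_⟩⟩
      · rw [Nat.mem_divisors]
        exact ⟨by rw [← Int.natCast_dvd_natCast]; simp [hd], hM⟩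
      · simpa using hd1
      · rcases Int.natAbs_eq d1 with h | h
        · exact ⟨d2, by rw [← h, hd], hd2⟩
        · exact ⟨-d2, by rw [hd]; nth_rewrite 1 [h]; ring, by simpa using hd2⟩
    · exact ⟨0, fun h => absurd h hp⟩
  choose G hG using hG
  have h1 : S.card ≤ 10 * (S.image G).card := by
    refine Finset.card_le_mul_card_image S 10 fun g hg => ?_
    rw [Finset.mem_image] at hg
    obtain ⟨⟨u, v⟩, hp, rfl⟩ := hg
    obtain ⟨hgd, hg1, h, hMgh, hh1⟩ := hG _ hp
    obtain ⟨huv, huvc⟩ := hS _ hp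
    obtain ⟨hMx, hMy⟩ := key _ hxy
    obtain ⟨hMu, hMv⟩ := key _ hp
    set g : ℕ := G (u, v) with hgdef
    simp only at hg1 hh1 huv huvc hMx hMy hMu hMv
    have hg0 : (g:ℤ) ≠ 0 := by rintro h0; rw [h0] at hMgh; simp at hMgh; exact hM hMgh
    have hd2 : ((Int.gcd g h : ℕ) : ℤ) ∣ 2 := by
      have hdg : ((Int.gcd g h : ℕ) : ℤ) ∣ g := Int.gcd_dvd_left ..
      have hdh : ((Int.gcd g h : ℕ) : ℤ) ∣ h := Int.gcd_dvd_right ..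
      have hdM : ((Int.gcd g h : ℕ) : ℤ) ∣ M := by rw [hMgh]; exact hdg.mul_right _
      have : ((Int.gcd g h : ℕ) : ℤ) ∣ 2 * (x * v) := by
        have := dvd_add (hdg.trans hg1) (hdh.trans hh1)
        have e : 2 * (x * v) = x * v - u * y + (x * v + u * y) := by ring
        rw [e]; exact this
      exact ((hMx.mul_right hMv).of_isCoprime_of_dvd_left hdM).dvd_of_dvd_mul_right this
    have hfib : ∀ p ∈ S.filter (fun p => G p = g), (M:ℤ) ∣ 2 * (v * p.1 - u * p.2) := by
      rintro ⟨u', v'⟩ hp'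
      rw [Finset.mem_filter] at hp'
      obtain ⟨hp', hgg⟩ := hp'
      obtain ⟨-, hg1', h', hMgh', hh1'⟩ := hG _ hp'
      rw [hgg] at hg1' hMgh'
      have : h' = h := by
        apply mul_left_cancel₀ hg0; rw [← hMgh, ← hMgh']
      subst this
      simp only at hg1' hh1' ⊢
      obtain ⟨α, β, hαβ⟩ := hcop
      set t := v * u' - u * v' with ht
      have hgt : (g:ℤ) ∣ t := by
        have : t = (α * u' + β * v') * (x * v - u * y) - (α * u + β * v) * (x * v' - u' * y) := by
          rw [ht]; linear_combination (-(v * u' - u * v')) * hαβ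
        rw [this]
        exact dvd_sub (hg1.mul_left _) (hg1'.mul_left _)
      have hht : h' ∣ t := by
        have : t = (α * u' - β * v') * (x * v + u * y) - (α * u - β * v) * (x * v' + u' * y) := by
          rw [ht]; linear_combination (-(v * u' - u * v')) * hαβ
        rw [this]
        exact dvd_sub (hh1.mul_left _) (hh1'.mul_left _)
      have h3 : (M:ℤ) ∣ (Int.gcd g h' : ℕ) * t := by
        rw [Int.gcd_eq_gcd_ab, add_mul, hMgh]
        refine dvd_add ?_ ?_
        · rw [mul_assoc]; exact mul_dvd_mul_left _ (hht.mul_left _)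
        · rw [mul_comm (g:ℤ) h', mul_assoc]; exact mul_dvd_mul_left _ (hgt.mul_left _)
      exact h3.trans (mul_dvd_mul_right hd2 _)
    have hcard : ((Finset.Icc (-2:ℤ) 2) ×ˢ (Finset.univ : Finset Bool)).card = 10 := by decide
    rw [← hcard]
    refine Finset.card_le_card_of_injOn
      (fun p => (2 * (v * p.1 - u * p.2) / M, decide (0 ≤ a * u * p.1 + b * v * p.2))) ?_ ?_
    · rintro ⟨u', v'⟩ hp'
      obtain ⟨j, hj⟩ := hfib _ hp'
      have h2 := (hS _ (Finset.mem_filter.mp hp').1).1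
      simp only at hj h2
      simp only [Finset.coe_product, Set.mem_prod, Finset.mem_coe, Finset.mem_Icc, Finset.mem_univ, and_true]
      rw [hj, Int.mul_ediv_cancel_left _ hM0]
      have hid : (a * u * u' + b * v * v') ^ 2 + a * b * (v * u' - u * v') ^ 2 = (M:ℤ) ^ 2 := by
        linear_combination (a * u' ^ 2 + b * v' ^ 2) * huv + M * h2
      have hab1 : 1 ≤ a * b := by nlinarith
      have hle : (v * u' - u * v') ^ 2 ≤ (M:ℤ) ^ 2 := by
        nlinarith [sq_nonneg (a * u * u' + b * v * v'), sq_nonneg (v * u' - u * v')]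
      have hle2 : ((M:ℤ) * j) ^ 2 ≤ (2 * M) ^ 2 := by rw [← hj]; nlinarith
      have := abs_le_of_sq_le_sq' hle2 (by positivity)
      constructor
      · nlinarith
      · nlinarith
    · rintro ⟨u1, v1⟩ hp1 ⟨u2, v2⟩ hp2 heq
      obtain ⟨j1, hj1⟩ := hfib _ hp1
      obtain ⟨j2, hj2⟩ := hfib _ hp2
      have e1 := (hS _ (Finset.mem_filter.mp hp1).1).1
      have e2 := (hS _ (Finset.mem_filter.mp hp2).1).1
      simp only [Prod.mk.injEq, decide_eq_decide] at heq hj1 hj2 e1 e2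
      obtain ⟨hj, hs⟩ := heq
      rw [hj1, hj2, Int.mul_ediv_cancel_left _ hM0, Int.mul_ediv_cancel_left _ hM0] at hj
      subst hj
      have ht : v * u1 - u * v1 = v * u2 - u * v2 := by linarith
      have hid1 : (a * u * u1 + b * v * v1) ^ 2 + a * b * (v * u1 - u * v1) ^ 2 = (M:ℤ) ^ 2 := by
        linear_combination (a * u1 ^ 2 + b * v1 ^ 2) * huv + M * e1
      have hid2 : (a * u * u2 + b * v * v2) ^ 2 + a * b * (v * u2 - u * v2) ^ 2 = (M:ℤ) ^ 2 := by
        linear_combination (a * u2 ^ 2 + b * v2 ^ 2) * huv + M * e2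
      have hsq : (a * u * u1 + b * v * v1) ^ 2 = (a * u * u2 + b * v * v2) ^ 2 := by
        rw [ht] at hid1; linarith
      have hss : a * u * u1 + b * v * v1 = a * u * u2 + b * v * v2 := by
        rcases sq_eq_sq_iff_eq_or_eq_neg.mp hsq with h | h
        · exact h
        · by_cases h0 : 0 ≤ a * u * u1 + b * v * v1
          · have := hs.mp h0; linarith
          · have := mt hs.mpr h0; push Not at this h0; linarith
      have r1 : u1 = u2 := by
        apply mul_left_cancel₀ hM0
        rw [← huv]; linear_combination u * hss + b * v * ht
      have r2 : v1 = v2 := by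
        apply mul_left_cancel₀ hM0
        rw [← huv]; linear_combination v * hss - a * u * ht
      rw [r1, r2]
  refine h1.trans (Nat.mul_le_mul_left _ (Finset.card_le_card ?_))
  intro g hg
  obtain ⟨p, hp, rfl⟩ := Finset.mem_image.mp hg
  exact (hG p hp).1

theorem quad_prim (M : ℕ) (hM : M ≠ 0) : ∀ (a b : ℤ) (_ : 0 < a) (_ : 0 < b) (S : Finset (ℤ × ℤ))
    (_ : ∀ p ∈ S, a * p.1 ^ 2 + b * p.2 ^ 2 = M ∧ IsCoprime p.1 p.2),
    S.card ≤ 10 * M.divisors.card := by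
  induction M using Nat.strong_induction_on with
  | _ M ih =>
  intro a b ha hb S hS
  by_cases hab : ∀ p : ℤ, Prime p → p ∣ M → ¬ p ∣ a * b
  · exact quad_base M hM a b ha hb hab S hS
  push Not at hab
  obtain ⟨p0, hp0, hpM0, hpab0⟩ := hab
  obtain ⟨p, hp, hpM, hpab⟩ : ∃ p : ℕ, p.Prime ∧ p ∣ M ∧ (p:ℤ) ∣ a * b :=
    ⟨p0.natAbs, Int.prime_iff_natAbs_prime.mp hp0, by simpa using Int.natAbs_dvd_natAbs.mpr hpM0, by simpa using hpab0⟩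
  have hpz : Prime (p:ℤ) := Nat.prime_iff_prime_int.mp hp
  have hp0' : (p:ℤ) ≠ 0 := hpz.ne_zero
  have hppos : (0:ℤ) < p := by exact_mod_cast hp.pos
  obtain ⟨m, rfl⟩ := hpM
  have hm0 : m ≠ 0 := by rintro rfl; simp at hM
  have hlt : m < p * m := by
    have := hp.two_le
    have : 0 < m := Nat.pos_of_ne_zero hm0
    nlinarith
  have hdiv : m.divisors.card ≤ (p * m).divisors.card :=
    Finset.card_le_card (Nat.divisors_subset_of_dvd hM (Dvd.intro_left p rfl))
  have ih' := ih m hlt hm0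
  have fin : ∀ T : Finset (ℤ × ℤ), S.card ≤ T.card → T.card ≤ 10 * m.divisors.card →
    S.card ≤ 10 * (p * m).divisors.card := fun T h1 h2 => by omega
  by_cases hpa : (p:ℤ) ∣ a
  · obtain ⟨a', rfl⟩ := hpa
    have ha' : 0 < a' := pos_of_mul_pos_right ha hppos.le
    by_cases hpb : (p:ℤ) ∣ b
    · obtain ⟨b', rfl⟩ := hpb
      have hb' : 0 < b' := pos_of_mul_pos_right hb hppos.le
      refine fin S le_rfl (ih' a' b' ha' hb' S fun q hq => ⟨?_, (hS q hq).2⟩)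
      apply mul_left_cancel₀ hp0'
      have := (hS q hq).1
      push_cast at this
      linarith
    · have hq2 : ∀ q ∈ S, (p:ℤ) ∣ q.2 := by
        intro q hq
        have h := (hS q hq).1
        push_cast at h
        have : (p:ℤ) ∣ b * q.2 ^ 2 := ⟨m - a' * q.1 ^ 2, by linarith⟩
        exact hpz.dvd_of_dvd_pow ((hpz.dvd_or_dvd this).resolve_left hpb)
      refine fin (S.image fun q => (q.1, q.2 / p)) (le_of_eq ?_) (ih' a' (b * p) ha' (by positivity) _ ?_)
      · rw [Finset.card_image_of_injOn]
        rintro ⟨u, v⟩ hq ⟨u', v'⟩ hq' h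
        simp only [Prod.mk.injEq] at h
        have h1 := Int.mul_ediv_cancel' (hq2 _ hq)
        have h2 := Int.mul_ediv_cancel' (hq2 _ hq')
        simp only at h1 h2
        rw [h.2] at h1
        rw [h.1, ← h1, h2]
      · intro r hr
        obtain ⟨⟨u, v⟩, hq, rfl⟩ := Finset.mem_image.mp hr
        obtain ⟨v', hv'⟩ := hq2 _ hq
        obtain ⟨e, c⟩ := hS _ hq
        simp only at hv' e c ⊢
        subst hv'
        rw [Int.mul_ediv_cancel_left _ hp0']
        refine ⟨?_, c.of_mul_right_right⟩
        apply mul_left_cancel₀ hp0'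
        push_cast at e
        linarith
  · have hpb : (p:ℤ) ∣ b := (hpz.dvd_or_dvd hpab).resolve_left hpa
    obtain ⟨b', rfl⟩ := hpb
    have hb' : 0 < b' := pos_of_mul_pos_right hb hppos.le
    have hq2 : ∀ q ∈ S, (p:ℤ) ∣ q.1 := by
      intro q hq
      have h := (hS q hq).1
      push_cast at h
      have : (p:ℤ) ∣ a * q.1 ^ 2 := ⟨m - b' * q.2 ^ 2, by linarith⟩
      exact hpz.dvd_of_dvd_pow ((hpz.dvd_or_dvd this).resolve_left hpa)
    refine fin (S.image fun q => (q.1 / p, q.2)) (le_of_eq ?_) (ih' (a * p) b' (by positivity) hb' _ ?_)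
    · rw [Finset.card_image_of_injOn]
      rintro ⟨u, v⟩ hq ⟨u', v'⟩ hq' h
      simp only [Prod.mk.injEq] at h
      have h1 := Int.mul_ediv_cancel' (hq2 _ hq)
      have h2 := Int.mul_ediv_cancel' (hq2 _ hq')
      simp only at h1 h2
      rw [h.1] at h1
      rw [h.2, ← h1, h2]
    · intro r hr
      obtain ⟨⟨u, v⟩, hq, rfl⟩ := Finset.mem_image.mp hr
      obtain ⟨v', hv'⟩ := hq2 _ hq
      obtain ⟨e, c⟩ := hS _ hq
      simp only at hv' e c ⊢
      subst hv'
      rw [Int.mul_ediv_cancel_left _ hp0']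
      refine ⟨?_, c.of_mul_left_right⟩
      apply mul_left_cancel₀ hp0'
      push_cast at e
      linarith

theorem quad_all (M : ℕ) (hM : M ≠ 0) (a b : ℤ) (ha : 0 < a) (hb : 0 < b) (S : Finset (ℤ × ℤ))
    (hS : ∀ p ∈ S, a * p.1 ^ 2 + b * p.2 ^ 2 = M) :
    S.card ≤ 10 * M.divisors.card * M.divisors.card := by
  have hf : ∀ p ∈ S, ∃ k : ℕ, M = (Int.gcd p.1 p.2) ^ 2 * k := by
    intro p hp
    obtain ⟨α, hα⟩ := Int.gcd_dvd_left (a := p.1) (b := p.2)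
    obtain ⟨β, hβ⟩ := Int.gcd_dvd_right (a := p.1) (b := p.2)
    have : (((Int.gcd p.1 p.2) ^ 2 : ℕ) : ℤ) ∣ M := by
      refine ⟨a * α ^ 2 + b * β ^ 2, ?_⟩
      rw [← hS p hp]
      push_cast
      generalize ((Int.gcd p.1 p.2 : ℕ) : ℤ) = g at *
      rw [hα, hβ]; ring
    exact Int.natCast_dvd_natCast.mp this
  have h1 : S.card ≤ (10 * M.divisors.card) * (S.image fun p => Int.gcd p.1 p.2).card := by
    refine Finset.card_le_mul_card_image S _ fun g hg => ?_
    obtain ⟨p, hp, hpg⟩ := Finset.mem_image.mp hg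
    obtain ⟨k, hk⟩ := hf p hp
    rw [hpg] at hk
    have hg0 : g ≠ 0 := by rintro rfl; simp at hk; exact hM hk
    have hk0 : k ≠ 0 := by rintro rfl; simp at hk; exact hM hk
    have hgz : (g:ℤ) ≠ 0 := by exact_mod_cast hg0
    have hdk : k.divisors.card ≤ M.divisors.card :=
      Finset.card_le_card (Nat.divisors_subset_of_dvd hM (Dvd.intro_left _ hk.symm))
    have hred : ∀ q ∈ S.filter (fun p => Int.gcd p.1 p.2 = g), ∃ u v : ℤ, q = (g * u, g * v) ∧ IsCoprime u v := by
      rintro ⟨u, v⟩ hq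
      have hq2 := (Finset.mem_filter.mp hq).2
      simp only at hq2
      obtain ⟨α, hα⟩ := Int.gcd_dvd_left (a := u) (b := v)
      obtain ⟨β, hβ⟩ := Int.gcd_dvd_right (a := u) (b := v)
      rw [hq2] at hα hβ
      refine ⟨α, β, by rw [← hα, ← hβ], ?_⟩
      rw [hα, hβ, Int.gcd_mul_left] at hq2
      rw [Int.isCoprime_iff_gcd_eq_one]
      simp only [Int.natAbs_natCast] at hq2
      exact Nat.eq_of_mul_eq_mul_left (Nat.pos_of_ne_zero hg0) (by omega)
    have h2 : (((S.filter (fun p => Int.gcd p.1 p.2 = g))).image fun q => (q.1 / (g:ℤ), q.2 / (g:ℤ))).card ≤ 10 * k.divisors.card := by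
      refine quad_prim k hk0 a b ha hb _ ?_
      intro r hr
      obtain ⟨q, hq, rfl⟩ := Finset.mem_image.mp hr
      obtain ⟨u, v, rfl, hc⟩ := hred q hq
      have e := hS _ (Finset.mem_filter.mp hq).1
      simp only at e ⊢
      rw [Int.mul_ediv_cancel_left _ hgz, Int.mul_ediv_cancel_left _ hgz]
      refine ⟨?_, hc⟩
      apply mul_left_cancel₀ (pow_ne_zero 2 hgz)
      rw [hk] at e
      push_cast at e
      linarith
    rw [Finset.card_image_of_injOn] at h2
    · exact h2.trans (Nat.mul_le_mul_left _ hdk)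
    · intro q hq q' hq' h
      obtain ⟨u, v, rfl, hc⟩ := hred q hq
      obtain ⟨u', v', rfl, hc'⟩ := hred q' hq'
      simp only [Int.mul_ediv_cancel_left _ hgz, Prod.mk.injEq] at h
      rw [h.1, h.2]
  refine h1.trans (Nat.mul_le_mul_left _ (Finset.card_le_card ?_))
  intro g hg
  obtain ⟨p, hp, rfl⟩ := Finset.mem_image.mp hg
  obtain ⟨k, hk⟩ := hf p hp
  rw [Nat.mem_divisors]
  exact ⟨⟨Int.gcd p.1 p.2 * k, by rw [← mul_assoc, ← sq]; exact hk⟩, hM⟩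
theorem plane_count {ι : Type*} (S : Finset ι) (n1 n2 n3 : ι → ℤ)
    (hinj : ∀ i ∈ S, ∀ j ∈ S, n1 i = n1 j → n2 i = n2 j → n3 i = n3 j → i = j)
    (w1 w2 w3 N k : ℤ) (hw : w3 ≠ 0)
    (hN : ∀ i ∈ S, n1 i ^ 2 + n2 i ^ 2 + n3 i ^ 2 = N)
    (hk : ∀ i ∈ S, w1 * n1 i + w2 * n2 i + w3 * n3 i = k)
    (C δ B : ℝ) (hC1 : 1 ≤ C) (hδ : 0 < δ)
    (hC : ∀ n : ℕ, n ≠ 0 → (n.divisors.card : ℝ) ≤ C * (n : ℝ) ^ δ) (hB1 : 1 ≤ B)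
    (hB : (((w1 ^ 2 + w3 ^ 2) * w3 ^ 2 * ((w1 ^ 2 + w2 ^ 2 + w3 ^ 2) * N) : ℤ) : ℝ) ≤ B) :
    (S.card : ℝ) ≤ 10 * (C * B ^ δ) ^ 2 := by
  classical
  have hw2 : 0 < w3 ^ 2 := by positivity
  have ha : 0 < w1 ^ 2 + w3 ^ 2 := by positivity
  have hW : 0 < w1 ^ 2 + w2 ^ 2 + w3 ^ 2 := by positivity
  have hBδ : 1 ≤ B ^ δ := Real.one_le_rpow hB1 hδ.le
  have hCB : 1 ≤ C * B ^ δ := one_le_mul_of_one_le_of_one_le hC1 hBδ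
  rcases S.eq_empty_or_nonempty with rfl | ⟨i0, hi0⟩
  · simp; positivity
  set F : ι → ℤ × ℤ := fun i =>
    ((w1 ^ 2 + w3 ^ 2) * (n2 i * w3 - n3 i * w2) + w1 * w2 * (n3 i * w1 - n1 i * w3),
      w3 * (n3 i * w1 - n1 i * w3)) with hF
  set Mz : ℤ := (w1 ^ 2 + w3 ^ 2) * w3 ^ 2 * ((w1 ^ 2 + w2 ^ 2 + w3 ^ 2) * N - k ^ 2) with hMz
  have hFM : ∀ i ∈ S, 1 * (F i).1 ^ 2 + (w1 ^ 2 + w2 ^ 2 + w3 ^ 2) * (F i).2 ^ 2 = Mz := by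
    intro i hi
    simp only [hF, hMz]
    rw [← hN i hi, ← hk i hi]
    ring
  have hFinj : Set.InjOn F S := by
    intro i hi j hj h
    simp only [hF, Prod.mk.injEq] at h
    obtain ⟨h1, h2⟩ := h
    have e2 : n3 i * w1 - n1 i * w3 = n3 j * w1 - n1 j * w3 := mul_left_cancel₀ hw h2
    rw [e2] at h1
    have e1 : n2 i * w3 - n3 i * w2 = n2 j * w3 - n3 j * w2 :=
      mul_left_cancel₀ ha.ne' (add_right_cancel h1)
    have e3 : n1 i * w2 - n2 i * w1 = n1 j * w2 - n2 j * w1 := by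
      apply mul_left_cancel₀ hw
      linear_combination (-w1) * e1 - w2 * e2
    have e4 : w1 * n1 i + w2 * n2 i + w3 * n3 i = w1 * n1 j + w2 * n2 j + w3 * n3 j := by
      rw [hk i hi, hk j hj]
    apply hinj i hi j hj
    · apply mul_left_cancel₀ hW.ne'
      linear_combination w1 * e4 + w2 * e3 - w3 * e2
    · apply mul_left_cancel₀ hW.ne'
      linear_combination w2 * e4 + w3 * e1 - w1 * e3
    · apply mul_left_cancel₀ hW.ne'
      linear_combination w3 * e4 + w1 * e2 - w2 * e1
  rw [← Finset.card_image_of_injOn hFinj]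
  have hMz0 : 0 ≤ Mz := by rw [← hFM i0 hi0]; positivity
  obtain ⟨M, hM⟩ := Int.eq_ofNat_of_zero_le hMz0
  by_cases hM0 : M = 0
  · have : (S.image F).card ≤ 1 := by
      rw [Finset.card_le_one]
      have h0 : ∀ p ∈ S.image F, p = (0, 0) := by
        intro p hp
        obtain ⟨i, hi, rfl⟩ := Finset.mem_image.mp hp
        have h := hFM i hi
        rw [hM, hM0] at h
        simp only [Nat.cast_zero] at h
        have s1 : (F i).1 ^ 2 = 0 := by nlinarith [sq_nonneg (F i).1, mul_nonneg hW.le (sq_nonneg (F i).2)]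
        have s2 : (F i).2 ^ 2 = 0 := by nlinarith [sq_nonneg (F i).2, mul_nonneg hW.le (sq_nonneg (F i).2)]
        exact Prod.ext (pow_eq_zero_iff (two_ne_zero) |>.mp s1) (pow_eq_zero_iff (two_ne_zero) |>.mp s2)
      intro p hp q hq
      rw [h0 p hp, h0 q hq]
    have h1 : ((S.image F).card : ℝ) ≤ 1 := by exact_mod_cast this
    nlinarith
  · have h1 := quad_all M hM0 1 (w1 ^ 2 + w2 ^ 2 + w3 ^ 2) one_pos hW (S.image F) (by
      intro p hp
      obtain ⟨i, hi, rfl⟩ := Finset.mem_image.mp hp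
      rw [hFM i hi, hM])
    have h2 : ((S.image F).card : ℝ) ≤ 10 * M.divisors.card * M.divisors.card := by exact_mod_cast h1
    have hMB : (M:ℝ) ≤ B := by
      have : (M:ℤ) ≤ (w1 ^ 2 + w3 ^ 2) * w3 ^ 2 * ((w1 ^ 2 + w2 ^ 2 + w3 ^ 2) * N) := by
        rw [← hM, hMz]
        apply mul_le_mul_of_nonneg_left _ (by positivity)
        nlinarith [sq_nonneg k]
      have : (M:ℝ) ≤ (((w1 ^ 2 + w3 ^ 2) * w3 ^ 2 * ((w1 ^ 2 + w2 ^ 2 + w3 ^ 2) * N) : ℤ) : ℝ) := by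
        exact_mod_cast this
      linarith
    have h3 : (M.divisors.card : ℝ) ≤ C * B ^ δ := (hC M hM0).trans
      (mul_le_mul_of_nonneg_left (Real.rpow_le_rpow (by positivity) hMB hδ.le) (by linarith))
    have h4 : (0:ℝ) ≤ M.divisors.card := by positivity
    nlinarith

theorem dirichlet2 (α β : ℝ) (K : ℕ) (hK : 0 < K) : ∃ q : ℕ, 1 ≤ q ∧ q ≤ K ^ 2 ∧ ∃ p1 p2 : ℤ,
    |q * α - p1| ≤ 1 / K ∧ |q * β - p2| ≤ 1 / K := by
  have hKr : (0:ℝ) < K := by exact_mod_cast hK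
  have hcard : (Finset.range K ×ˢ Finset.range K).card < (Finset.range (K ^ 2 + 1)).card := by
    simp; nlinarith
  have hlt : ∀ z : ℝ, ⌊K * Int.fract z⌋₊ < K := by
    intro z
    rw [Nat.floor_lt (by have := Int.fract_nonneg z; positivity)]
    nlinarith [Int.fract_lt_one z]
  have habs : ∀ z z' : ℝ, ⌊K * Int.fract z⌋₊ = ⌊K * Int.fract z'⌋₊ →
      |z' - z - ((⌊z'⌋ - ⌊z⌋ : ℤ) : ℝ)| ≤ 1 / K := by
    intro z z' h
    have e : z' - z - ((⌊z'⌋ - ⌊z⌋ : ℤ) : ℝ) = Int.fract z' - Int.fract z := by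
      simp only [Int.fract]; push_cast; ring
    rw [e, le_div_iff₀ hKr]
    have h0 : 0 ≤ K * Int.fract z := by have := Int.fract_nonneg z; positivity
    have h0' : 0 ≤ K * Int.fract z' := by have := Int.fract_nonneg z'; positivity
    have a1 := Nat.floor_le h0
    have a2 := Nat.lt_floor_add_one (K * Int.fract z)
    have b1 := Nat.floor_le h0'
    have b2 := Nat.lt_floor_add_one (K * Int.fract z')
    rw [h] at a1 a2
    rw [← abs_of_pos hKr, ← abs_mul, abs_le]
    constructor <;> nlinarith
  obtain ⟨x, hx, y, hy, hxy, hf⟩ := Finset.exists_ne_map_eq_of_card_lt_of_maps_to hcard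
    (f := fun q : ℕ => (⌊K * Int.fract ((q:ℝ) * α)⌋₊, ⌊K * Int.fract ((q:ℝ) * β)⌋₊))
    (by intro q _; simp only [Finset.coe_product, Set.mem_prod, Finset.coe_range, Set.mem_Iio]; exact ⟨hlt _, hlt _⟩)
  have main : ∀ x y : ℕ, x ∈ Finset.range (K ^ 2 + 1) → y ∈ Finset.range (K ^ 2 + 1) → x < y →
      (⌊K * Int.fract ((x:ℝ) * α)⌋₊ = ⌊K * Int.fract ((y:ℝ) * α)⌋₊) →
      (⌊K * Int.fract ((x:ℝ) * β)⌋₊ = ⌊K * Int.fract ((y:ℝ) * β)⌋₊) →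
      ∃ q : ℕ, 1 ≤ q ∧ q ≤ K ^ 2 ∧ ∃ p1 p2 : ℤ,
        |q * α - p1| ≤ 1 / K ∧ |q * β - p2| ≤ 1 / K := by
    intro x y hx hy hxy h1 h2
    simp only [Finset.mem_range] at hx hy
    refine ⟨y - x, by omega, by omega, ⌊(y:ℝ) * α⌋ - ⌊(x:ℝ) * α⌋, ⌊(y:ℝ) * β⌋ - ⌊(x:ℝ) * β⌋, ?_, ?_⟩
    · have := habs _ _ h1
      rwa [← sub_mul, ← Nat.cast_sub hxy.le] at this
    · have := habs _ _ h2
      rwa [← sub_mul, ← Nat.cast_sub hxy.le] at this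
  simp only [Prod.mk.injEq] at hf
  rcases lt_or_gt_of_ne hxy with h | h
  · exact main x y hx hy h hf.1 hf.2
  · exact main y x hy hx h hf.1.symm hf.2.symm

theorem card_int_le (T : Finset ℤ) (L : ℝ) (hL : 0 ≤ L)
    (h : ∀ x ∈ T, ∀ y ∈ T, ((x - y : ℤ) : ℝ) ≤ L) : (T.card : ℝ) ≤ L + 1 := by
  rcases T.eq_empty_or_nonempty with rfl | hT
  · simp; linarith
  have hsub : T ⊆ Finset.Icc (T.min' hT) (T.min' hT + ⌊L⌋) := by
    intro x hx
    rw [Finset.mem_Icc]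
    refine ⟨T.min'_le x hx, ?_⟩
    have := Int.le_floor.mpr (h x hx _ (T.min'_mem hT))
    linarith
  have h1 := Finset.card_le_card hsub
  rw [Int.card_Icc] at h1
  have h2 : (T.card : ℤ) ≤ ⌊L⌋ + 1 := by
    have : 0 ≤ ⌊L⌋ := Int.floor_nonneg.mpr hL
    omega
  have h3 : (T.card : ℝ) ≤ ⌊L⌋ + 1 := by exact_mod_cast h2
  linarith [Int.floor_le L]

set_option maxHeartbeats 1000000 in
theorem slab_count (ε : ℝ) (hε : 0 < ε) : ∃ C : ℝ, 0 < C ∧ ∀ (ι : Type) (S : Finset ι)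
    (n1 n2 n3 : ι → ℤ)
    (_ : ∀ i ∈ S, ∀ j ∈ S, n1 i = n1 j → n2 i = n2 j → n3 i = n3 j → i = j)
    (lam : ℝ) (_ : 1 ≤ lam)
    (_ : ∀ i ∈ S, (n1 i : ℝ) ^ 2 + (n2 i : ℝ) ^ 2 + (n3 i : ℝ) ^ 2 = lam ^ 2)
    (v1 v2 v3 : ℝ) (_ : v1 ^ 2 + v2 ^ 2 + v3 ^ 2 = 1) (_ : v1 ^ 2 ≤ v3 ^ 2) (_ : v2 ^ 2 ≤ v3 ^ 2)
    (A : ℝ) (_ : ∀ i ∈ S, A ≤ n1 i * v1 + n2 i * v2 + n3 i * v3 ∧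
      n1 i * v1 + n2 i * v2 + n3 i * v3 ≤ A + 1),
    (S.card : ℝ) ≤ C * lam ^ ((2:ℝ) / 3 + ε) := by
  obtain ⟨D, hD1, hD⟩ := divisor_bound (ε / 12) (by positivity)
  refine ⟨10 * (D * (200000:ℝ) ^ (ε / 12)) ^ 2 * 13, by positivity, ?_⟩
  intro ι S n1 n2 n3 hinj lam hlam hN v1 v2 v3 hv h13 h23 A hA
  classical
  rcases S.eq_empty_or_nonempty with rfl | ⟨i0, hi0⟩
  · simp; positivity
  have hl0 : 0 < lam := by linarith
  set ρ : ℝ := lam ^ ((1:ℝ) / 3) with hρ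
  have hρ1 : 1 ≤ ρ := Real.one_le_rpow hlam (by norm_num)
  have hρ3 : ρ ^ 3 = lam := by
    rw [hρ, ← Real.rpow_natCast, ← Real.rpow_mul hl0.le]; norm_num
  have hρ2 : ρ ^ 2 = lam ^ ((2:ℝ) / 3) := by
    rw [hρ, ← Real.rpow_natCast, ← Real.rpow_mul hl0.le]; norm_num
  set K : ℕ := ⌈ρ⌉₊ with hK
  have hKρ : ρ ≤ K := Nat.le_ceil ρ
  have hK2 : (K:ℝ) ≤ 2 * ρ := by
    have := Nat.ceil_lt_add_one (a := ρ) (by linarith)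
    linarith
  have hK0r : (0:ℝ) < K := by linarith
  have hK0 : 0 < K := by exact_mod_cast hK0r
  have hv3 : 1 ≤ 4 * v3 ^ 2 := by nlinarith
  have hv30 : v3 ≠ 0 := by rintro rfl; norm_num at hv3
  obtain ⟨q, hq1, hqK, p1, p2, hp1, hp2⟩ := dirichlet2 (v1 / v3) (v2 / v3) K hK0
  have hq1r : (1:ℝ) ≤ q := by exact_mod_cast hq1
  have hqρ : (q:ℝ) ≤ 4 * ρ ^ 2 := by
    have : (q:ℝ) ≤ (K:ℝ) ^ 2 := by exact_mod_cast hqK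
    nlinarith
  have hKinv : 1 / (K:ℝ) ≤ 1 / ρ := one_div_le_one_div_of_le (by linarith) hKρ
  have hKinv1 : 1 / (K:ℝ) ≤ 1 := hKinv.trans (by rw [div_le_one (by linarith)]; exact hρ1)
  have hpb : ∀ (p : ℤ) (u : ℝ), u ^ 2 ≤ v3 ^ 2 → |q * (u / v3) - p| ≤ 1 / K → (p:ℝ) ^ 2 ≤ 4 * q ^ 2 := by
    intro p u hu hp
    have h1 : |u / v3| ≤ 1 := by
      rw [abs_div, div_le_one (abs_pos.mpr hv30)]
      exact sq_le_sq.mp hu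
    have h2 : |(q:ℝ) * (u / v3)| ≤ q := by
      rw [abs_mul, Nat.abs_cast]; nlinarith
    rw [abs_le] at hp h2
    have : |(p:ℝ)| ≤ 2 * q := by rw [abs_le]; constructor <;> linarith
    have := sq_le_sq' (by linarith [abs_le.mp this]) (abs_le.mp this).2
    linarith
  have hp1b := hpb p1 v1 h13 hp1
  have hp2b := hpb p2 v2 h23 hp2
  -- component bound
  have hcomp : ∀ i ∈ S, |(n1 i : ℝ)| ≤ lam ∧ |(n2 i : ℝ)| ≤ lam := by
    intro i hi
    have := hN i hi
    constructor
    · apply abs_le_of_sq_le_sq _ hl0.le; nlinarith [sq_nonneg (n2 i : ℝ), sq_nonneg (n3 i : ℝ)]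
    · apply abs_le_of_sq_le_sq _ hl0.le; nlinarith [sq_nonneg (n1 i : ℝ), sq_nonneg (n3 i : ℝ)]
  have hlamK : lam * (1 / K) ≤ ρ ^ 2 := by
    rw [mul_one_div, div_le_iff₀ hK0r, ← hρ3]; nlinarith [sq_nonneg ρ]
  have hθ : ∀ i ∈ S, |((p1 * n1 i + p2 * n2 i + q * n3 i : ℤ) : ℝ) -
      q / v3 * (n1 i * v1 + n2 i * v2 + n3 i * v3)| ≤ 2 * ρ ^ 2 := by
    intro i hi
    obtain ⟨c1, c2⟩ := hcomp i hi
    have e : ((p1 * n1 i + p2 * n2 i + q * n3 i : ℤ) : ℝ) -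
      q / v3 * (n1 i * v1 + n2 i * v2 + n3 i * v3) =
      -((q * (v1 / v3) - p1) * n1 i) - (q * (v2 / v3) - p2) * n2 i := by
      push_cast; field_simp; ring
    rw [e]
    have f1 : |(q * (v1 / v3) - p1) * n1 i| ≤ ρ ^ 2 := by
      rw [abs_mul]
      calc _ ≤ 1 / (K:ℝ) * lam := mul_le_mul hp1 c1 (abs_nonneg _) (by positivity)
        _ ≤ _ := by linarith
    have f2 : |(q * (v2 / v3) - p2) * n2 i| ≤ ρ ^ 2 := by
      rw [abs_mul]
      calc _ ≤ 1 / (K:ℝ) * lam := mul_le_mul hp2 c2 (abs_nonneg _) (by positivity)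
        _ ≤ _ := by linarith
    rw [abs_le] at f1 f2 ⊢
    constructor <;> linarith
  have hqv : |(q:ℝ) / v3| ≤ 8 * ρ ^ 2 := by
    rw [abs_div, Nat.abs_cast, div_le_iff₀ (abs_pos.mpr hv30)]
    have : 1 ≤ 2 * |v3| := by
      have := sq_abs v3
      nlinarith [abs_nonneg v3]
    have h8 := mul_le_mul_of_nonneg_left this (by positivity : 0 ≤ 4 * ρ ^ 2)
    linarith
  have himg : ((S.image fun i => p1 * n1 i + p2 * n2 i + q * n3 i).card : ℝ) ≤ 13 * ρ ^ 2 := by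
    have := card_int_le (S.image fun i => p1 * n1 i + p2 * n2 i + q * n3 i) (12 * ρ ^ 2) (by positivity) (by
      intro x hx y hy
      obtain ⟨i, hi, rfl⟩ := Finset.mem_image.mp hx
      obtain ⟨j, hj, rfl⟩ := Finset.mem_image.mp hy
      have a1 := abs_le.mp (hθ i hi)
      have a2 := abs_le.mp (hθ j hj)
      have b1 := hA i hi
      have b2 := hA j hj
      have c : |(q:ℝ) / v3 * ((n1 i * v1 + n2 i * v2 + n3 i * v3) - (n1 j * v1 + n2 j * v2 + n3 j * v3))| ≤ 8 * ρ ^ 2 * 1 := by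
        rw [abs_mul]
        refine mul_le_mul hqv ?_ (abs_nonneg _) (by positivity)
        rw [abs_le]; constructor <;> linarith
      have c2 := (abs_le.mp c).2
      rw [mul_sub] at c2
      rw [Int.cast_sub]
      linarith)
    nlinarith
  obtain ⟨N, hNz⟩ : ∃ N : ℤ, (N:ℝ) = lam ^ 2 :=
    ⟨n1 i0 ^ 2 + n2 i0 ^ 2 + n3 i0 ^ 2, by push_cast; exact hN i0 hi0⟩
  set R : ℝ := 10 * (D * (200000 * lam ^ 6) ^ (ε / 12)) ^ 2 with hR
  have hR0 : 0 ≤ R := by positivity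
  have hfib : S.card ≤ ⌊R⌋₊ * (S.image fun i => p1 * n1 i + p2 * n2 i + q * n3 i).card := by
    refine Finset.card_le_mul_card_image S _ fun k _ => ?_
    apply Nat.le_floor
    have hsub : ∀ i ∈ S.filter (fun i => p1 * n1 i + p2 * n2 i + q * n3 i = k), i ∈ S := fun i hi =>
      (Finset.mem_filter.mp hi).1
    refine plane_count _ n1 n2 n3 (fun i hi j hj => hinj i (hsub i hi) j (hsub j hj)) p1 p2 q N k
      (by exact_mod_cast (by omega : q ≠ 0)) ?_ (fun i hi => (Finset.mem_filter.mp hi).2) D (ε / 12) _ hD1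
      (by positivity) hD ?_ ?_
    · intro i hi
      have := hN i (hsub i hi)
      rw [← hNz] at this
      exact_mod_cast this
    · have : 1 ≤ lam ^ 6 := one_le_pow₀ hlam
      linarith
    · push_cast
      rw [hNz]
      have hq2 : (0:ℝ) ≤ (q:ℝ) ^ 2 := by positivity
      have g1 : ((p1:ℝ) ^ 2 + q ^ 2) * q ^ 2 * ((p1 ^ 2 + p2 ^ 2 + q ^ 2) * lam ^ 2) ≤
          (5 * q ^ 2) * q ^ 2 * ((9 * q ^ 2) * lam ^ 2) := by
        gcongr <;> linarith
      have g2 : (q:ℝ) ^ 6 ≤ (4 * ρ ^ 2) ^ 6 := by gcongr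
      have g3 : (4 * ρ ^ 2) ^ 6 = 4096 * lam ^ 4 := by rw [← hρ3]; ring
      rw [g3] at g2
      calc _ ≤ _ := g1
        _ = 45 * lam ^ 2 * (q:ℝ) ^ 6 := by ring
        _ ≤ 45 * lam ^ 2 * (4096 * lam ^ 4) := by gcongr
        _ = 184320 * lam ^ 6 := by ring
        _ ≤ _ := by gcongr; norm_num
  have hRl : R = 10 * (D * (200000:ℝ) ^ (ε / 12)) ^ 2 * lam ^ ε := by
    rw [hR, Real.mul_rpow (by norm_num) (by positivity)]
    have : (lam ^ 6) ^ (ε / 12) * (lam ^ 6) ^ (ε / 12) = lam ^ ε := by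
      rw [← Real.rpow_natCast, ← Real.rpow_mul hl0.le, ← Real.rpow_add hl0]; congr 1; push_cast; ring
    rw [← this]; ring
  calc (S.card : ℝ) ≤ (⌊R⌋₊ : ℝ) * (S.image fun i => p1 * n1 i + p2 * n2 i + q * n3 i).card := by
        exact_mod_cast hfib
    _ ≤ R * (13 * ρ ^ 2) := mul_le_mul (Nat.floor_le hR0) himg (by positivity) hR0
    _ = _ := by rw [hRl, hρ2, Real.rpow_add hl0]; ring

theorem slab_count' (ε : ℝ) (hε : 0 < ε) : ∃ C : ℝ, 0 < C ∧ ∀ (S : Finset (Fin 3 → ℤ))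
    (lam : ℝ) (_ : 1 ≤ lam) (_ : ∀ n ∈ S, (∑ i, ((n i : ℝ)) ^ 2) = lam ^ 2)
    (v : Fin 3 → ℝ) (_ : (∑ i, (v i) ^ 2) = 1)
    (A : ℝ) (_ : ∀ n ∈ S, A ≤ ∑ i, (n i : ℝ) * v i ∧ ∑ i, (n i : ℝ) * v i ≤ A + 1),
    (S.card : ℝ) ≤ C * lam ^ ((2:ℝ) / 3 + ε) := by
  obtain ⟨C, hC0, hC⟩ := slab_count ε hε
  refine ⟨C, hC0, ?_⟩
  intro S lam hlam hN v hv A hA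
  simp only [Fin.sum_univ_three] at hN hv hA
  have ext3 : ∀ f g : Fin 3 → ℤ, f 0 = g 0 → f 1 = g 1 → f 2 = g 2 → f = g := by
    intro f g h0 h1 h2
    funext i; fin_cases i <;> assumption
  by_cases h1 : (v 0) ^ 2 ≤ (v 2) ^ 2 ∧ (v 1) ^ 2 ≤ (v 2) ^ 2
  · exact hC _ S (fun n => n 0) (fun n => n 1) (fun n => n 2) (fun i _ j _ => ext3 i j) lam hlam hN
      (v 0) (v 1) (v 2) hv h1.1 h1.2 A hA
  by_cases h2 : (v 0) ^ 2 ≤ (v 1) ^ 2 ∧ (v 2) ^ 2 ≤ (v 1) ^ 2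
  · exact hC _ S (fun n => n 0) (fun n => n 2) (fun n => n 1) (fun i _ j _ a b c => ext3 i j a c b) lam hlam
      (fun n hn => by rw [← hN n hn]; ring)
      (v 0) (v 2) (v 1) (by linarith) h2.1 h2.2 A (fun n hn => by
        have := hA n hn; constructor <;> linarith)
  · have h3 : (v 2) ^ 2 ≤ (v 0) ^ 2 ∧ (v 1) ^ 2 ≤ (v 0) ^ 2 := by
      by_contra h3
      rcases le_total ((v 0) ^ 2) ((v 1) ^ 2) with a | a <;>
      rcases le_total ((v 0) ^ 2) ((v 2) ^ 2) with b | b <;>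
      rcases le_total ((v 1) ^ 2) ((v 2) ^ 2) with c | c <;> first | tauto | exact h1 ⟨by linarith, by linarith⟩ | exact h2 ⟨by linarith, by linarith⟩
    exact hC _ S (fun n => n 2) (fun n => n 1) (fun n => n 0) (fun i _ j _ a b c => ext3 i j c b a) lam hlam
      (fun n hn => by rw [← hN n hn]; ring)
      (v 2) (v 1) (v 0) (by linarith) h3.1 h3.2 A (fun n hn => by
        have := hA n hn; constructor <;> linarith)

theorem kernel_bound (x : ℝ) :
    ‖∫ t in (0:ℝ)..1, Complex.exp (Complex.I * x * t)‖ ≤ 4 / ((⌊|x|⌋₊ : ℝ) + 1) := by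
  by_cases hx : |x| < 1
  · have : ⌊|x|⌋₊ = 0 := Nat.floor_eq_zero.mpr hx
    rw [this]
    have h := intervalIntegral.norm_integral_le_of_norm_le_const (a := (0:ℝ)) (b := 1) (C := 1)
      (f := fun t : ℝ => Complex.exp (Complex.I * x * t)) (fun t _ => by
        rw [Complex.norm_exp]; simp)
    simp only [sub_zero, abs_one, mul_one] at h
    norm_num
    linarith
  · push Not at hx
    have hx0 : x ≠ 0 := by rintro rfl; norm_num at hx
    have hc : Complex.I * x ≠ 0 := mul_ne_zero Complex.I_ne_zero (by exact_mod_cast hx0)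
    rw [integral_exp_mul_complex hc, norm_div]
    have h1 : ‖Complex.I * (x:ℂ)‖ = |x| := by simp
    rw [h1]
    have h2 : ‖Complex.exp (Complex.I * x * (1:ℝ)) - Complex.exp (Complex.I * x * (0:ℝ))‖ ≤ 2 := by
      refine (norm_sub_le _ _).trans ?_
      rw [Complex.norm_exp, Complex.norm_exp]; simp; norm_num
    have h3 := Nat.floor_le (abs_nonneg x)
    rw [div_le_div_iff₀ (by linarith) (by positivity)]
    nlinarith [norm_nonneg (Complex.exp (Complex.I * x * (1:ℝ)) - Complex.exp (Complex.I * x * (0:ℝ))), (Nat.cast_nonneg ⌊|x|⌋₊ : (0:ℝ) ≤ _)]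

theorem sieve {ι : Type} (E : Finset ι) (μ : ι → ℝ) (b : ι → ℂ) (R : ℝ)
    (hR : ∀ n ∈ E, ∑ m ∈ E, 4 / ((⌊|μ n - μ m|⌋₊ : ℝ) + 1) ≤ R) :
    (∫ t in (0:ℝ)..1, ‖∑ n ∈ E, b n * Complex.exp (Complex.I * μ n * t)‖ ^ 2) ≤
      R * ∑ n ∈ E, ‖b n‖ ^ 2 := by
  have hexp : ∀ t : ℝ, ((‖∑ n ∈ E, b n * Complex.exp (Complex.I * μ n * t)‖ ^ 2 : ℝ) : ℂ) =
      ∑ n ∈ E, ∑ m ∈ E, b n * (starRingEnd ℂ) (b m) * Complex.exp (Complex.I * (μ n - μ m : ℝ) * t) := by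
    intro t
    push_cast
    rw [← Complex.mul_conj', map_sum, Finset.sum_mul_sum]
    refine Finset.sum_congr rfl fun n _ => Finset.sum_congr rfl fun m _ => ?_
    rw [map_mul, ← Complex.exp_conj]
    simp only [map_mul, Complex.conj_I, Complex.conj_ofReal]
    have : Complex.exp (Complex.I * (μ n - μ m) * t) = Complex.exp (Complex.I * μ n * t) * Complex.exp (-Complex.I * μ m * t) := by
      rw [← Complex.exp_add]; congr 1; ring
    rw [this]; ring
  have hint : ((∫ t in (0:ℝ)..1, ‖∑ n ∈ E, b n * Complex.exp (Complex.I * μ n * t)‖ ^ 2 : ℝ) : ℂ) =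
      ∑ n ∈ E, ∑ m ∈ E, b n * (starRingEnd ℂ) (b m) *
        ∫ t in (0:ℝ)..1, Complex.exp (Complex.I * (μ n - μ m : ℝ) * t) := by
    rw [← intervalIntegral.integral_ofReal]
    simp_rw [hexp]
    rw [intervalIntegral.integral_finsetSum]
    · refine Finset.sum_congr rfl fun n _ => ?_
      rw [intervalIntegral.integral_finsetSum]
      · refine Finset.sum_congr rfl fun m _ => ?_
        rw [intervalIntegral.integral_const_mul]
      · intro m _
        apply Continuous.intervalIntegrable; fun_prop
    · intro m _
      apply Continuous.intervalIntegrable; fun_prop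
  set κ : ι → ι → ℝ := fun n m => 4 / ((⌊|μ n - μ m|⌋₊ : ℝ) + 1) with hκ
  have hsymm : ∀ n m, κ n m = κ m n := fun n m => by simp only [hκ, abs_sub_comm]
  have hκ0 : ∀ n m, 0 ≤ κ n m := fun n m => by simp only [hκ]; positivity
  calc _ ≤ ‖((∫ t in (0:ℝ)..1, ‖∑ n ∈ E, b n * Complex.exp (Complex.I * μ n * t)‖ ^ 2 : ℝ) : ℂ)‖ := by
        rw [Complex.norm_real]; exact Real.le_norm_self _
    _ ≤ ∑ n ∈ E, ∑ m ∈ E, ‖b n‖ * ‖b m‖ * κ n m := by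
        rw [hint]
        refine (norm_sum_le _ _).trans (Finset.sum_le_sum fun n _ => ?_)
        refine (norm_sum_le _ _).trans (Finset.sum_le_sum fun m _ => ?_)
        rw [norm_mul, norm_mul, RCLike.norm_conj]
        exact mul_le_mul_of_nonneg_left (kernel_bound _) (by positivity)
    _ ≤ ∑ n ∈ E, ∑ m ∈ E, (‖b n‖ ^ 2 * κ n m / 2 + ‖b m‖ ^ 2 * κ m n / 2) := by
        refine Finset.sum_le_sum fun n _ => Finset.sum_le_sum fun m _ => ?_
        rw [hsymm m n]
        nlinarith [mul_nonneg (sq_nonneg (‖b n‖ - ‖b m‖)) (hκ0 n m)]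
    _ = ∑ n ∈ E, ‖b n‖ ^ 2 * ∑ m ∈ E, κ n m := by
        simp_rw [Finset.sum_add_distrib]
        rw [Finset.sum_comm (f := fun n m => ‖b m‖ ^ 2 * κ m n / 2), ← Finset.sum_add_distrib]
        refine Finset.sum_congr rfl fun n _ => ?_
        rw [← Finset.sum_add_distrib, Finset.mul_sum]
        refine Finset.sum_congr rfl fun m _ => by ring
    _ ≤ ∑ n ∈ E, ‖b n‖ ^ 2 * R := by
        refine Finset.sum_le_sum fun n hn => mul_le_mul_of_nonneg_left (hR n hn) (by positivity)
    _ = _ := by rw [← Finset.sum_mul, mul_comm]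

theorem row_sum {ι : Type} (E : Finset ι) (μ : ι → ℝ) (A lam : ℝ) (hlam : 1 ≤ lam)
    (hμ : ∀ n ∈ E, |μ n| ≤ lam)
    (hA : ∀ (S : Finset ι) (a : ℝ), S ⊆ E → (∀ n ∈ S, a ≤ μ n ∧ μ n ≤ a + 1) → (S.card : ℝ) ≤ A)
    (n : ι) (hn : n ∈ E) :
    ∑ m ∈ E, 4 / ((⌊|μ n - μ m|⌋₊ : ℝ) + 1) ≤ 8 * A * (1 + Real.log (3 * lam)) := by
  classical
  have hA0 : 0 ≤ A := by simpa using hA ∅ 0 (by simp) (by simp)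
  set J : ℕ := ⌊2 * lam⌋₊ + 1 with hJ
  have hmaps : ∀ m ∈ E, ⌊|μ n - μ m|⌋₊ ∈ Finset.range J := by
    intro m hm
    rw [Finset.mem_range, hJ, Nat.lt_add_one_iff]
    apply Nat.floor_le_floor
    have h1 := abs_le.mp (hμ n hn)
    have h2 := abs_le.mp (hμ m hm)
    rw [abs_le]; constructor <;> linarith
  rw [← Finset.sum_fiberwise_of_maps_to hmaps]
  have hfib : ∀ j ∈ Finset.range J, ∑ m ∈ E with ⌊|μ n - μ m|⌋₊ = j, 4 / ((⌊|μ n - μ m|⌋₊ : ℝ) + 1) ≤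
      8 * A * ((j:ℝ) + 1)⁻¹ := by
    intro j _
    have e : ∑ m ∈ E with ⌊|μ n - μ m|⌋₊ = j, 4 / ((⌊|μ n - μ m|⌋₊ : ℝ) + 1) =
        ∑ m ∈ E with ⌊|μ n - μ m|⌋₊ = j, 4 / ((j : ℝ) + 1) :=
      Finset.sum_congr rfl fun m hm => by rw [(Finset.mem_filter.mp hm).2]
    rw [e, Finset.sum_const, nsmul_eq_mul]
    have hsub : (E.filter fun m => ⌊|μ n - μ m|⌋₊ = j) ⊆
        (E.filter fun m => μ n + j ≤ μ m ∧ μ m ≤ μ n + j + 1) ∪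
        (E.filter fun m => μ n - j - 1 ≤ μ m ∧ μ m ≤ μ n - j - 1 + 1) := by
      intro m hm
      obtain ⟨hm, hj⟩ := Finset.mem_filter.mp hm
      rw [Nat.floor_eq_iff (abs_nonneg _)] at hj
      rw [Finset.mem_union, Finset.mem_filter, Finset.mem_filter]
      rcases abs_cases (μ n - μ m) with h | h
      · right; refine ⟨hm, ?_, ?_⟩ <;> linarith
      · left; refine ⟨hm, ?_, ?_⟩ <;> linarith
    have hc : ((E.filter fun m => ⌊|μ n - μ m|⌋₊ = j).card : ℝ) ≤ 2 * A := by
      have h1 := (Finset.card_le_card hsub).trans (Finset.card_union_le _ _)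
      have h2 := hA (E.filter fun m => μ n + j ≤ μ m ∧ μ m ≤ μ n + j + 1) (μ n + j) (Finset.filter_subset _ _)
        (fun m hm => (Finset.mem_filter.mp hm).2)
      have h3 := hA (E.filter fun m => μ n - j - 1 ≤ μ m ∧ μ m ≤ μ n - j - 1 + 1) (μ n - j - 1) (Finset.filter_subset _ _)
        (fun m hm => (Finset.mem_filter.mp hm).2)
      have h4 : ((E.filter fun m => ⌊|μ n - μ m|⌋₊ = j).card : ℝ) ≤ _ := Nat.cast_le.mpr h1
      push_cast at h4
      linarith
    calc _ ≤ 2 * A * (4 / ((j:ℝ) + 1)) := mul_le_mul_of_nonneg_right hc (by positivity)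
      _ = _ := by rw [div_eq_mul_inv]; ring
  refine (Finset.sum_le_sum hfib).trans ?_
  rw [← Finset.mul_sum]
  refine mul_le_mul_of_nonneg_left ?_ (by positivity)
  have h1 := harmonic_le_one_add_log J
  rw [harmonic] at h1
  push_cast at h1
  refine h1.trans ?_
  have : Real.log J ≤ Real.log (3 * lam) := by
    apply Real.log_le_log (by rw [hJ]; positivity)
    rw [hJ]; push_cast
    have := Nat.floor_le (a := 2 * lam) (by linarith)
    linarith
  linarith

theorem stmt6 (ε : ℝ) (hε : 0 < ε) :
    ∃ C : ℝ, 0 < C ∧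
      ∀ (lam : ℝ), 1 ≤ lam →
        ∀ (x₀ v : Fin 3 → ℝ), (∑ i, (v i) ^ 2) = 1 →
          ∀ (E : Finset (Fin 3 → ℤ)),
            (∀ n : Fin 3 → ℤ, n ∈ E ↔ (∑ i, ((n i : ℝ)) ^ 2) = lam ^ 2) →
              ∀ (c : (Fin 3 → ℤ) → ℂ),
                (∫ t in (0 : ℝ)..1,
                    ‖∑ n ∈ E, c n *
                      Complex.exp (Complex.I * (dotIR n (fun i => x₀ i + t * v i) : ℂ))‖ ^ 2)
                  ≤ C * lam ^ ((2 : ℝ) / 3 + ε) * ∑ n ∈ E, ‖c n‖ ^ 2 := by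
  obtain ⟨C, hC0, hC⟩ := slab_count' (ε / 2) (by positivity)
  refine ⟨8 * C * (4 + 1 / (ε / 2)), by positivity, ?_⟩
  intro lam hlam x₀ v hv E hE c
  have hl0 : 0 < lam := by linarith
  set A : ℝ := C * lam ^ ((2 : ℝ) / 3 + ε / 2) with hA
  have hμ : ∀ n ∈ E, |dotIR n v| ≤ lam := by
    intro n hn
    apply abs_le_of_sq_le_sq _ hl0.le
    have := Finset.sum_mul_sq_le_sq_mul_sq Finset.univ (fun i => (n i : ℝ)) v
    rw [hv, (hE n).mp hn, mul_one] at this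
    exact this
  have hrow := row_sum E (fun n => dotIR n v) A lam hlam hμ (fun S a hS h =>
    hC S lam hlam (fun n hn => (hE n).mp (hS hn)) v hv a h)
  have hs := sieve E (fun n => dotIR n v) (fun n => c n * Complex.exp (Complex.I * dotIR n x₀)) _ hrow
  have hnorm : ∀ n, ‖c n * Complex.exp (Complex.I * dotIR n x₀)‖ = ‖c n‖ := by
    intro n; rw [norm_mul, Complex.norm_exp]; simp
  simp_rw [hnorm] at hs
  have hfun : ∀ t : ℝ, ∑ n ∈ E, c n * Complex.exp (Complex.I * dotIR n x₀) * Complex.exp (Complex.I * dotIR n v * t)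
      = ∑ n ∈ E, c n * Complex.exp (Complex.I * (dotIR n (fun i => x₀ i + t * v i) : ℂ)) := by
    intro t
    refine Finset.sum_congr rfl fun n _ => ?_
    rw [mul_assoc, ← Complex.exp_add]
    congr 2
    have : dotIR n (fun i => x₀ i + t * v i) = dotIR n x₀ + dotIR n v * t := by
      simp only [dotIR, Fin.sum_univ_three]; ring
    rw [this]; push_cast; ring
  simp_rw [hfun] at hs
  refine hs.trans (mul_le_mul_of_nonneg_right ?_ (by positivity))
  have hlog : 1 + Real.log (3 * lam) ≤ (4 + 1 / (ε / 2)) * lam ^ (ε / 2) := by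
    rw [Real.log_mul (by norm_num) hl0.ne']
    have h1 := Real.log_le_rpow_div hl0.le (half_pos hε)
    have h2 : Real.log 3 ≤ 3 - 1 := Real.log_le_sub_one_of_pos (by norm_num)
    have h3 : 1 ≤ lam ^ (ε / 2) := Real.one_le_rpow hlam (by positivity)
    rw [add_mul, one_div_mul_eq_div]
    linarith
  calc 8 * A * (1 + Real.log (3 * lam)) ≤ 8 * A * ((4 + 1 / (ε / 2)) * lam ^ (ε / 2)) :=
        mul_le_mul_of_nonneg_left hlog (by positivity)
    _ = 8 * C * (4 + 1 / (ε / 2)) * (lam ^ ((2 : ℝ) / 3 + ε / 2) * lam ^ (ε / 2)) := by rw [hA]; ring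
    _ = _ := by rw [← Real.rpow_add hl0]; congr 2; ring
end
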